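/- arXiv:1602.00473 — 2 statements merged into one kernel-verified Lean document; each statement's English description precedes it below -/
import Mathlib

section
/- Let X be a Banach space and Γ : [0,1] → cwk(X) a variationally Henstock integrable multifunction. Then every strongly measurable selection of Γ is variationally Henstock integrable. -/
open Set Metric MeasureTheory Pointwise
open scoped ENNReal NNReal

namespace GaugePaper

variable (X : Type*) [NormedAddCommGroup X] [NormedSpace ℝ X]

/-- `A ∈ cwk(X)`: `A` is a nonempty, convex and weakly compact subset of `X`. -/
def IsCWK (A : Set X) : Prop :=
  A.Nonempty ∧ Convex ℝ A ∧ IsCompact (toWeakSpace ℝ X '' A)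

variable {X}

/-- The support function `σ(x*, A)`. -/
noncomputable def suppFn (x' : X →L[ℝ] ℝ) (A : Set X) : ℝ := sSup (x' '' A)

/-- `‖A‖ = sup {‖x‖ : x ∈ A}`. -/
noncomputable def setNorm (A : Set X) : ℝ := sSup ((fun x => ‖x‖) '' A)

/-- A gauge on `[0,1]`: a positive function. -/
def IsGauge (δ : ℝ → ℝ) : Prop := ∀ t ∈ Icc (0:ℝ) 1, 0 < δ t

/-- A tagged partition of `[0,1]` into `n` (possibly degenerate) nonoverlapping closed
subintervals `[pt i, pt (i+1)]`, with tags `tag i ∈ [0,1]`. -/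
structure TP (n : ℕ) where
  pt : Fin (n + 1) → ℝ
  tag : Fin n → ℝ
  mono : Monotone pt
  first : pt 0 = 0
  last : pt (Fin.last n) = 1
  tagMem : ∀ i, tag i ∈ Icc (0:ℝ) 1

namespace TP

variable {n : ℕ} (P : TP n)

/-- The `i`-th subinterval of the partition. -/
def ivl (i : Fin n) : Set ℝ := Icc (P.pt i.castSucc) (P.pt i.succ)

/-- The length `|I_i|` of the `i`-th subinterval. -/
def len (i : Fin n) : ℝ := P.pt i.succ - P.pt i.castSucc

/-- A Perron (Henstock) partition: each tag belongs to its interval. -/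
def IsPerron : Prop := ∀ i, P.tag i ∈ P.ivl i

/-- `δ`-fineness: `I_i ⊆ (t_i - δ(t_i), t_i + δ(t_i))`. -/
def IsFine (δ : ℝ → ℝ) : Prop :=
  ∀ i, P.ivl i ⊆ Ioo (P.tag i - δ (P.tag i)) (P.tag i + δ (P.tag i))

/-- An interior Henstock partition: each tag is in the interior of its interval, except
possibly for intervals containing `0` or `1`, where the tag may also be `0` or `1`. -/
def IsInterior : Prop :=
  ∀ i, P.tag i ∈ Ioo (P.pt i.castSucc) (P.pt i.succ) ∨
    (((0:ℝ) ∈ P.ivl i ∨ (1:ℝ) ∈ P.ivl i) ∧ P.tag i ∈ P.ivl i ∩ ({0, 1} : Set ℝ))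

end TP

/-- Riemann sum of a multifunction: `∑ i |I_i| • Γ(t_i)` (Minkowski sums). -/
def mSum {n : ℕ} (P : TP n) (Γ : ℝ → Set X) : Set X :=
  ∑ i : Fin n, P.len i • Γ (P.tag i)

/-- Riemann sum of a function: `∑ i |I_i| • f(t_i)`. -/
def fSum {n : ℕ} (P : TP n) (f : ℝ → X) : X :=
  ∑ i : Fin n, P.len i • f (P.tag i)

/-! ### Gauge integrals of multifunctions -/

/-- Henstock integrability of a multifunction `Γ : [0,1] → cwk(X)`. -/
def HenstockIntegrable (Γ : ℝ → Set X) : Prop :=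
  ∃ I : Set X, IsCWK X I ∧ ∀ ε > 0, ∃ δ : ℝ → ℝ, IsGauge δ ∧
    ∀ (n : ℕ) (P : TP n), P.IsPerron → P.IsFine δ → hausdorffDist I (mSum P Γ) < ε

/-- McShane integrability of a multifunction (free tags). -/
def McShaneIntegrable (Γ : ℝ → Set X) : Prop :=
  ∃ I : Set X, IsCWK X I ∧ ∀ ε > 0, ∃ δ : ℝ → ℝ, IsGauge δ ∧
    ∀ (n : ℕ) (P : TP n), P.IsFine δ → hausdorffDist I (mSum P Γ) < ε

/-- `ℋ`-integrability: Henstock integrability with Lebesgue measurable gauges. -/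
def HMeasIntegrable (Γ : ℝ → Set X) : Prop :=
  ∃ I : Set X, IsCWK X I ∧ ∀ ε > 0, ∃ δ : ℝ → ℝ, IsGauge δ ∧ AEMeasurable δ volume ∧
    ∀ (n : ℕ) (P : TP n), P.IsPerron → P.IsFine δ → hausdorffDist I (mSum P Γ) < ε

/-- Birkhoff (`ℳ`-) integrability: McShane integrability with Lebesgue measurable gauges. -/
def BirkhoffIntegrable (Γ : ℝ → Set X) : Prop :=
  ∃ I : Set X, IsCWK X I ∧ ∀ ε > 0, ∃ δ : ℝ → ℝ, IsGauge δ ∧ AEMeasurable δ volume ∧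
    ∀ (n : ℕ) (P : TP n), P.IsFine δ → hausdorffDist I (mSum P Γ) < ε

/-! ### Gauge integrals of (single-valued) functions -/

/-- Henstock integrability of a function `f : [0,1] → X`. -/
def FHenstockIntegrable (f : ℝ → X) : Prop :=
  ∃ w : X, ∀ ε > 0, ∃ δ : ℝ → ℝ, IsGauge δ ∧
    ∀ (n : ℕ) (P : TP n), P.IsPerron → P.IsFine δ → ‖w - fSum P f‖ < ε

/-- McShane integrability of a function. -/
def FMcShaneIntegrable (f : ℝ → X) : Prop :=
  ∃ w : X, ∀ ε > 0, ∃ δ : ℝ → ℝ, IsGauge δ ∧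
    ∀ (n : ℕ) (P : TP n), P.IsFine δ → ‖w - fSum P f‖ < ε

/-- `ℋ`-integrability of a function: measurable gauges. -/
def FHMeasIntegrable (f : ℝ → X) : Prop :=
  ∃ w : X, ∀ ε > 0, ∃ δ : ℝ → ℝ, IsGauge δ ∧ AEMeasurable δ volume ∧
    ∀ (n : ℕ) (P : TP n), P.IsPerron → P.IsFine δ → ‖w - fSum P f‖ < ε

/-- Birkhoff (`ℳ`-) integrability of a function: McShane with measurable gauges. -/
def FBirkhoffIntegrable (f : ℝ → X) : Prop :=
  ∃ w : X, ∀ ε > 0, ∃ δ : ℝ → ℝ, IsGauge δ ∧ AEMeasurable δ volume ∧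
    ∀ (n : ℕ) (P : TP n), P.IsFine δ → ‖w - fSum P f‖ < ε

/-- Henstock–Kurzweil integrability of a real-valued function on `[0,1]`. -/
def HKIntegrable (g : ℝ → ℝ) : Prop :=
  ∃ A : ℝ, ∀ ε > 0, ∃ δ : ℝ → ℝ, IsGauge δ ∧
    ∀ (n : ℕ) (P : TP n), P.IsPerron → P.IsFine δ → |fSum P g - A| < ε

/-! ### Pettis integrals -/

/-- Pettis integrability of a function `f : [0,1] → X`. -/
def FPettisIntegrable (f : ℝ → X) : Prop :=
  (∀ x' : X →L[ℝ] ℝ, IntegrableOn (fun t => x' (f t)) (Icc (0:ℝ) 1) volume) ∧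
  ∀ E ⊆ Icc (0:ℝ) 1, NullMeasurableSet E volume →
    ∃ ν : X, ∀ x' : X →L[ℝ] ℝ, x' ν = ∫ t in E, x' (f t)

/-- Pettis integrability of a multifunction `Γ : [0,1] → cwk(X)`. -/
def PettisIntegrable (Γ : ℝ → Set X) : Prop :=
  (∀ x' : X →L[ℝ] ℝ, IntegrableOn (fun t => suppFn x' (Γ t)) (Icc (0:ℝ) 1) volume) ∧
  ∀ E ⊆ Icc (0:ℝ) 1, NullMeasurableSet E volume →
    ∃ W : Set X, IsCWK X W ∧ ∀ x' : X →L[ℝ] ℝ, suppFn x' W = ∫ t in E, suppFn x' (Γ t)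

/-- `f` is a selection of `Γ`. -/
def Selection (Γ : ℝ → Set X) (f : ℝ → X) : Prop := ∀ t ∈ Icc (0:ℝ) 1, f t ∈ Γ t

/-! ### Variational integrals -/

/-- Finite additivity of an interval multifunction on subintervals of `[0,1]`
(an interval `[a,b] ⊆ [0,1]` is encoded by its endpoints). -/
def AdditiveIntervalMF (Φ : ℝ → ℝ → Set X) : Prop :=
  ∀ a b c : ℝ, 0 ≤ a → a ≤ b → b ≤ c → c ≤ 1 → Φ a c = Φ a b + Φ b c

/-- Finite additivity of a vector-valued interval function on subintervals of `[0,1]`. -/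
def AdditiveIntervalF (Φ : ℝ → ℝ → X) : Prop :=
  ∀ a b c : ℝ, 0 ≤ a → a ≤ b → b ≤ c → c ≤ 1 → Φ a c = Φ a b + Φ b c

/-- `Φ` is a variational Henstock primitive of the multifunction `Γ`. -/
def vHPrimitive (Γ : ℝ → Set X) (Φ : ℝ → ℝ → Set X) : Prop :=
  (∀ a b : ℝ, 0 ≤ a → a ≤ b → b ≤ 1 → IsCWK X (Φ a b)) ∧ AdditiveIntervalMF Φ ∧
  ∀ ε > 0, ∃ δ : ℝ → ℝ, IsGauge δ ∧ ∀ (n : ℕ) (P : TP n), P.IsPerron → P.IsFine δ →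
    ∑ i : Fin n, hausdorffDist (Φ (P.pt i.castSucc) (P.pt i.succ)) (P.len i • Γ (P.tag i)) < ε

/-- Variational Henstock integrability of a multifunction. -/
def vHIntegrable (Γ : ℝ → Set X) : Prop := ∃ Φ : ℝ → ℝ → Set X, vHPrimitive Γ Φ

/-- Variational McShane integrability of a multifunction (free tags). -/
def vMSIntegrable (Γ : ℝ → Set X) : Prop :=
  ∃ Φ : ℝ → ℝ → Set X,
    (∀ a b : ℝ, 0 ≤ a → a ≤ b → b ≤ 1 → IsCWK X (Φ a b)) ∧ AdditiveIntervalMF Φ ∧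
    ∀ ε > 0, ∃ δ : ℝ → ℝ, IsGauge δ ∧ ∀ (n : ℕ) (P : TP n), P.IsFine δ →
      ∑ i : Fin n, hausdorffDist (Φ (P.pt i.castSucc) (P.pt i.succ)) (P.len i • Γ (P.tag i)) < ε

/-- Variational `ℋ`-integrability of a multifunction: measurable gauges. -/
def vHMeasIntegrable (Γ : ℝ → Set X) : Prop :=
  ∃ Φ : ℝ → ℝ → Set X,
    (∀ a b : ℝ, 0 ≤ a → a ≤ b → b ≤ 1 → IsCWK X (Φ a b)) ∧ AdditiveIntervalMF Φ ∧
    ∀ ε > 0, ∃ δ : ℝ → ℝ, IsGauge δ ∧ AEMeasurable δ volume ∧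
      ∀ (n : ℕ) (P : TP n), P.IsPerron → P.IsFine δ →
        ∑ i : Fin n, hausdorffDist (Φ (P.pt i.castSucc) (P.pt i.succ)) (P.len i • Γ (P.tag i)) < ε

/-- `Φ` is a variational Henstock primitive of the function `f`. -/
def FvHPrimitive (f : ℝ → X) (Φ : ℝ → ℝ → X) : Prop :=
  AdditiveIntervalF Φ ∧
  ∀ ε > 0, ∃ δ : ℝ → ℝ, IsGauge δ ∧ ∀ (n : ℕ) (P : TP n), P.IsPerron → P.IsFine δ →
    ∑ i : Fin n, ‖Φ (P.pt i.castSucc) (P.pt i.succ) - P.len i • f (P.tag i)‖ < ε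

/-- Variational Henstock integrability of a function. -/
def FvHIntegrable (f : ℝ → X) : Prop := ∃ Φ : ℝ → ℝ → X, FvHPrimitive f Φ

/-- Variational McShane integrability of a function (free tags). -/
def FvMSIntegrable (f : ℝ → X) : Prop :=
  ∃ Φ : ℝ → ℝ → X, AdditiveIntervalF Φ ∧
    ∀ ε > 0, ∃ δ : ℝ → ℝ, IsGauge δ ∧ ∀ (n : ℕ) (P : TP n), P.IsFine δ →
      ∑ i : Fin n, ‖Φ (P.pt i.castSucc) (P.pt i.succ) - P.len i • f (P.tag i)‖ < ε

/-- Variational `ℋ`-integrability of a function: measurable gauges. -/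
def FvHMeasIntegrable (f : ℝ → X) : Prop :=
  ∃ Φ : ℝ → ℝ → X, AdditiveIntervalF Φ ∧
    ∀ ε > 0, ∃ δ : ℝ → ℝ, IsGauge δ ∧ AEMeasurable δ volume ∧
      ∀ (n : ℕ) (P : TP n), P.IsPerron → P.IsFine δ →
        ∑ i : Fin n, ‖Φ (P.pt i.castSucc) (P.pt i.succ) - P.len i • f (P.tag i)‖ < ε

/-! ### Partial Perron partitions and variational measures -/

/-- A finite tagged Perron family of `n` nonoverlapping closed subintervals
`[a i, b i]` of `[0,1]` (a "partition in `[0,1]`", not necessarily covering it). -/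
structure PTP (n : ℕ) where
  a : Fin n → ℝ
  b : Fin n → ℝ
  tag : Fin n → ℝ
  le : ∀ i, a i ≤ b i
  sub : ∀ i, Icc (a i) (b i) ⊆ Icc (0:ℝ) 1
  nonoverlap : ∀ i j, i ≠ j → (Icc (a i) (b i) ∩ Icc (a j) (b j)).Subsingleton
  perron : ∀ i, tag i ∈ Icc (a i) (b i)

/-- `δ`-fineness of a partial Perron family. -/
def PTP.IsFine {n : ℕ} (P : PTP n) (δ : ℝ → ℝ) : Prop :=
  ∀ i, Icc (P.a i) (P.b i) ⊆ Ioo (P.tag i - δ (P.tag i)) (P.tag i + δ (P.tag i))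

/-- `Var(Ψ, δ, E)` for a scalar interval function `Ψ`. -/
noncomputable def scVar (Ψ : ℝ → ℝ → ℝ) (δ : ℝ → ℝ) (E : Set ℝ) : ℝ≥0∞ :=
  ⨆ (n : ℕ) (P : PTP n) (_ : P.IsFine δ ∧ ∀ i, P.tag i ∈ E),
    ∑ i : Fin n, ENNReal.ofReal |Ψ (P.a i) (P.b i)|

/-- The variational measure `V_Ψ(E)` generated by a scalar interval function `Ψ`. -/
noncomputable def scVarMeasure (Ψ : ℝ → ℝ → ℝ) (E : Set ℝ) : ℝ≥0∞ :=
  ⨅ (δ : ℝ → ℝ) (_ : IsGauge δ), scVar Ψ δ E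


section

open Filter Topology

/-! ### Fine chains of tagged intervals -/

/-- The tagged interval `([u, v], t)` is a `δ`-fine Perron interval. -/
def FineAt (δ : ℝ → ℝ) (u t v : ℝ) : Prop :=
  u ≤ t ∧ t ≤ v ∧ t - δ t < u ∧ v < t + δ t

theorem FineAt.mono {δ δ' : ℝ → ℝ} {u t v : ℝ} (h : FineAt δ u t v) (hδ : δ t ≤ δ' t) :
    FineAt δ' u t v :=
  ⟨h.1, h.2.1, by linarith [h.2.2.1], by linarith [h.2.2.2]⟩

/-- `Chain δ a b l`: the list `l` consists of consecutive `δ`-fine tagged Perron intervals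
`(u, t, v)` that partition `[a, b]`. -/
inductive Chain (δ : ℝ → ℝ) : ℝ → ℝ → List (ℝ × ℝ × ℝ) → Prop
  | nil (a : ℝ) : Chain δ a a []
  | cons {u t v b : ℝ} {l : List (ℝ × ℝ × ℝ)} :
      FineAt δ u t v → Chain δ v b l → Chain δ u b ((u, t, v) :: l)

namespace Chain

variable {δ : ℝ → ℝ}

theorem mono {δ' : ℝ → ℝ} (hδ : ∀ t, δ t ≤ δ' t) {a b : ℝ} {l : List (ℝ × ℝ × ℝ)}
    (h : Chain δ a b l) : Chain δ' a b l := by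
  induction h with
  | nil a => exact .nil a
  | cons hf _ ih => exact .cons (hf.mono (hδ _)) ih

theorem append {a b c : ℝ} {l l' : List (ℝ × ℝ × ℝ)} (h : Chain δ a b l)
    (h' : Chain δ b c l') : Chain δ a c (l ++ l') := by
  induction h with
  | nil a => exact h'
  | cons hf _ ih => exact .cons hf (ih h')

theorem le {a b : ℝ} {l : List (ℝ × ℝ × ℝ)} (h : Chain δ a b l) : a ≤ b := by
  induction h with
  | nil a => exact le_rfl
  | cons hf _ ih => exact (hf.1.trans hf.2.1).trans ih

/-- Cousin's lemma. -/
theorem exists_chain (hδ : ∀ t, 0 < δ t) {a b : ℝ} (hab : a ≤ b) : ∃ l, Chain δ a b l := by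
  set S : Set ℝ := {x | x ∈ Icc a b ∧ ∃ l, Chain δ a x l} with hS
  have haS : a ∈ S := ⟨⟨le_rfl, hab⟩, [], .nil a⟩
  have hbdd : BddAbove S := ⟨b, fun x hx => hx.1.2⟩
  set c := sSup S with hc
  have hac : a ≤ c := le_csSup hbdd haS
  have hcb : c ≤ b := csSup_le ⟨a, haS⟩ fun x hx => hx.1.2
  obtain ⟨x, hxS, hx⟩ := exists_lt_of_lt_csSup ⟨a, haS⟩ (sub_lt_self c (hδ c))
  have hxc : x ≤ c := le_csSup hbdd hxS
  obtain ⟨l, hl⟩ := hxS.2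
  set d := min b (c + δ c / 2) with hd
  have hcd : c ≤ d := le_min hcb (by linarith [hδ c])
  have hdS : Chain δ a d (l ++ [(x, c, d)]) := by
    refine hl.append (.cons ⟨hxc, hcd, hx, ?_⟩ (.nil d))
    exact (min_le_right _ _).trans_lt (by linarith [hδ c])
  have hdc : d ≤ c := le_csSup hbdd ⟨⟨hac.trans hcd, min_le_left _ _⟩, _, hdS⟩
  have hdb : d = b := by
    rcases min_choice b (c + δ c / 2) with h | h
    · exact h
    · rw [hd, h] at hdc
      linarith [hδ c]
  exact ⟨_, hdb ▸ hdS⟩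

/-- A chain, indexed by an initial segment of the natural numbers. -/
theorem exists_fin {a b : ℝ} {l : List (ℝ × ℝ × ℝ)} (h : Chain δ a b l) :
    ∃ (n : ℕ) (pt : Fin (n + 1) → ℝ) (tag : Fin n → ℝ), pt 0 = a ∧ pt (Fin.last n) = b ∧
      (∀ i, FineAt δ (pt i.castSucc) (tag i) (pt i.succ)) ∧
      ∀ D : ℝ → ℝ → ℝ → ℝ, ∑ i, D (pt i.castSucc) (tag i) (pt i.succ) =
        (l.map fun p => D p.1 p.2.1 p.2.2).sum := by
  induction h with
  | nil a => exact ⟨0, fun _ => a, Fin.elim0, rfl, rfl, fun i => i.elim0, fun D => by simp⟩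
  | @cons u t v b l hf _ ih =>
    obtain ⟨n, pt, tag, h0, h1, hfine, hsum⟩ := ih
    refine ⟨n + 1, Fin.cons u pt, Fin.cons t tag, rfl, ?_, ?_, ?_⟩
    · rw [← Fin.succ_last, Fin.cons_succ, h1]
    · refine Fin.cases ?_ fun i => ?_
      · simpa [h0] using hf
      · simpa [← Fin.succ_castSucc] using hfine i
    · intro D
      rw [Fin.sum_univ_succ]
      simp [← hsum, h0]

/-- A subadditive estimate on the pieces of a chain adds up to an estimate on the whole. -/
theorem sum_le {a b : ℝ} {l : List (ℝ × ℝ × ℝ)} (h : Chain δ a b l) {D : ℝ → ℝ → ℝ → ℝ}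
    {W : ℝ → ℝ}
    (hD : ∀ u t v, a ≤ u → v ≤ b → FineAt δ u t v → D u t v ≤ W v - W u) :
    (l.map fun p => D p.1 p.2.1 p.2.2).sum ≤ W b - W a := by
  induction h with
  | nil a => simp
  | @cons u t v b l hf hl ih =>
    have h1 := hD u t v le_rfl hl.le hf
    have h2 := ih fun u' t' v' hu hv hf' => hD u' t' v' ((hf.1.trans hf.2.1).trans hu) hv hf'
    simp only [List.map_cons, List.sum_cons]
    linarith

end Chain

/-! ### Variationally negligible functions of tagged intervals -/

/-- `D` is variationally negligible: its sums over fine tagged Perron partitions of `[0,1]`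
can be controlled by the increments of monotone functions of small total increase. -/
def VarNull (D : ℝ → ℝ → ℝ → ℝ) : Prop :=
  ∀ ε > 0, ∃ δ : ℝ → ℝ, (∀ t, 0 < δ t) ∧ ∃ W : ℝ → ℝ, Monotone W ∧ (∀ x, W x ∈ Icc 0 ε) ∧
    ∀ u t v, 0 ≤ u → v ≤ 1 → FineAt δ u t v → D u t v ≤ W v - W u

theorem varNull_of_chain_sum_le {D : ℝ → ℝ → ℝ → ℝ} (hD : ∀ u t v, 0 ≤ D u t v)
    (h : ∀ ε > 0, ∃ δ : ℝ → ℝ, (∀ t, 0 < δ t) ∧ ∀ l, Chain δ 0 1 l →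
      (l.map fun p => D p.1 p.2.1 p.2.2).sum ≤ ε) : VarNull D := by
  intro ε hε
  obtain ⟨δ, hδ, hsum⟩ := h ε hε
  set S : List (ℝ × ℝ × ℝ) → ℝ := fun l => (l.map fun p => D p.1 p.2.1 p.2.2).sum with hSdef
  have hS0 : ∀ l, 0 ≤ S l := fun l => List.sum_nonneg (by
    intro x hx
    obtain ⟨p, -, rfl⟩ := List.mem_map.1 hx
    exact hD _ _ _)
  have hSapp : ∀ l l', S (l ++ l') = S l + S l' := fun l l' => by simp [hSdef]
  set V : ℝ → Set ℝ := fun x => S '' {l | Chain δ 0 x l} with hV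
  have hVle : ∀ x ≤ 1, ∀ y ∈ V x, y ≤ ε := by
    rintro x hx _ ⟨l, hl, rfl⟩
    obtain ⟨l', hl'⟩ := Chain.exists_chain hδ hx
    have := hsum _ (Chain.append hl hl')
    have h2 := hSapp l l'
    have h3 := hS0 l'
    simp only [hSdef] at *
    linarith
  have hne : ∀ x, 0 ≤ x → (V x).Nonempty := fun x hx => by
    obtain ⟨l, hl⟩ := Chain.exists_chain hδ hx
    exact ⟨_, l, hl, rfl⟩
  have hbdd : ∀ x ≤ 1, BddAbove (V x) := fun x hx => ⟨ε, hVle x hx⟩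
  have key : ∀ u v l, 0 ≤ u → v ≤ 1 → Chain δ u v l → S l ≤ sSup (V v) - sSup (V u) := by
    intro u v l hu hv hl
    have : sSup (V u) ≤ sSup (V v) - S l := by
      refine csSup_le (hne u hu) ?_
      rintro _ ⟨l', hl', rfl⟩
      have := le_csSup (hbdd v hv) ⟨_, Chain.append hl' hl, rfl⟩
      rw [hSapp] at this
      linarith
    linarith
  set cl : ℝ → ℝ := fun x => max 0 (min 1 x) with hcl
  have hcl0 : ∀ x, 0 ≤ cl x := fun x => le_max_left _ _
  have hcl1 : ∀ x, cl x ≤ 1 := fun x => max_le zero_le_one (min_le_left _ _)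
  refine ⟨δ, hδ, fun x => sSup (V (cl x)), ?_, ?_, ?_⟩
  · intro x y hxy
    have hxy' : cl x ≤ cl y := max_le_max le_rfl (min_le_min le_rfl hxy)
    obtain ⟨l, hl⟩ := Chain.exists_chain hδ hxy'
    have := key _ _ l (hcl0 x) (hcl1 y) hl
    have := hS0 l
    show sSup (V (cl x)) ≤ sSup (V (cl y))
    linarith
  · intro x
    refine ⟨?_, csSup_le (hne _ (hcl0 x)) (hVle _ (hcl1 x))⟩
    obtain ⟨_, l, hl, rfl⟩ := hne _ (hcl0 x)
    exact (hS0 l).trans (le_csSup (hbdd _ (hcl1 x)) ⟨l, hl, rfl⟩)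
  · intro u t v hu hv hf
    have huv : u ≤ v := hf.1.trans hf.2.1
    have hclu : cl u = u := by simp [hcl, hu, huv.trans hv]
    have hclv : cl v = v := by simp [hcl, hu.trans huv, hv]
    have := key u v _ hu hv (.cons hf (.nil v))
    simpa [hclu, hclv, hSdef] using this

theorem _root_.HasDerivAt.exists_increment_le {W : ℝ → ℝ} {r η t : ℝ} (h : HasDerivAt W r t)
    (hr : r < η) :
    ∃ ρ > 0, ∀ u v, FineAt (fun _ => ρ) u t v → W v - W u ≤ η * (v - u) := by
  have h1 := (hasDerivAt_iff_isLittleO.1 h).def (sub_pos.2 hr)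
  obtain ⟨ρ, hρ, hball⟩ := Metric.eventually_nhds_iff.1 h1
  refine ⟨ρ, hρ, fun u v ⟨hut, htv, hu, hv⟩ => ?_⟩
  have hu' := @hball u (by rw [Real.dist_eq, abs_sub_lt_iff]; constructor <;> linarith)
  have hv' := @hball v (by rw [Real.dist_eq, abs_sub_lt_iff]; constructor <;> linarith)
  simp only [smul_eq_mul, Real.norm_eq_abs] at hu' hv'
  rw [abs_of_nonpos (sub_nonpos.2 hut)] at hu'
  rw [abs_of_nonneg (sub_nonneg.2 htv)] at hv'
  have := (abs_le.1 hu').1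
  have := (abs_le.1 hv').2
  linarith

theorem _root_.Monotone.lintegral_rnDeriv_stieltjesFunction_le {W : ℝ → ℝ} (hW : Monotone W)
    {ε : ℝ} (hb : ∀ x, W x ∈ Icc 0 ε) :
    ∫⁻ x, hW.stieltjesFunction.measure.rnDeriv volume x ≤ ENNReal.ofReal ε := by
  refine Measure.lintegral_rnDeriv_le.trans ?_
  set F := hW.stieltjesFunction with hF
  have hF0 : ∀ x, F x ∈ Icc 0 ε := by
    intro x
    rw [hF, hW.stieltjesFunction_eq]
    refine ⟨(hb x).1.trans (hW.le_rightLim le_rfl), ?_⟩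
    exact (hW.rightLim_le (lt_add_one x)).trans (hb _).2
  have htop := tendsto_atTop_ciSup F.mono ⟨ε, by rintro _ ⟨x, rfl⟩; exact (hF0 x).2⟩
  have hbot := tendsto_atBot_ciInf F.mono ⟨0, by rintro _ ⟨x, rfl⟩; exact (hF0 x).1⟩
  rw [F.measure_univ hbot htop]
  refine ENNReal.ofReal_le_ofReal ?_
  have h1 : ⨆ x, F x ≤ ε := ciSup_le fun x => (hF0 x).2
  have h2 : 0 ≤ ⨅ x, F x := le_ciInf fun x => (hF0 x).1
  linarith

/-- A variationally negligible function is, at almost every tag, negligible with respect to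
the length of the interval. -/
theorem VarNull.ae_le {D : ℝ → ℝ → ℝ → ℝ} (h : VarNull D) :
    ∀ᵐ t : ℝ, ∀ η > 0, ∃ ρ > 0, ∀ u v, 0 ≤ u → v ≤ 1 → FineAt (fun _ => ρ) u t v →
      D u t v ≤ η * (v - u) := by
  choose δ hδ W hW hWb hDW using fun m : ℕ => h (1 / ((m : ℝ) + 1)) Nat.one_div_pos_of_nat
  set r : ℕ → ℝ → ℝ≥0∞ := fun m => (hW m).stieltjesFunction.measure.rnDeriv volume with hr
  have hr0 : ∀ᵐ t : ℝ, ⨅ m, r m t = 0 := by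
    have hmeas : Measurable fun t => ⨅ m, r m t :=
      Measurable.iInf fun m => Measure.measurable_rnDeriv _ _
    refine (lintegral_eq_zero_iff hmeas).1 (le_antisymm ?_ bot_le)
    have hlim : Tendsto (fun m : ℕ => ENNReal.ofReal (1 / ((m : ℝ) + 1))) atTop (𝓝 0) := by
      simpa using ENNReal.tendsto_ofReal tendsto_one_div_add_atTop_nhds_zero_nat
    refine ge_of_tendsto' hlim fun m => ?_
    exact (lintegral_mono fun t => iInf_le _ m).trans
      ((hW m).lintegral_rnDeriv_stieltjesFunction_le (hWb m))
  filter_upwards [hr0, ae_all_iff.2 fun m => (hW m).ae_hasDerivAt] with t ht hder η hη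
  obtain ⟨m, hm⟩ := iInf_lt_iff.1 (ht.trans_lt (ENNReal.ofReal_pos.2 hη))
  have hm' : (r m t).toReal < η := by
    rw [← ENNReal.toReal_ofReal hη.le]
    exact (ENNReal.toReal_lt_toReal hm.ne_top ENNReal.ofReal_ne_top).2 hm
  obtain ⟨ρ, hρ, hinc⟩ := (hder m).exists_increment_le hm'
  refine ⟨min ρ (δ m t), lt_min hρ (hδ m t), fun u v hu hv hf => ?_⟩
  exact (hDW m u t v hu hv (hf.mono (min_le_right _ _))).trans
    (hinc u v (hf.mono (min_le_left _ _)))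

/-- Almost every point of a measurable set is a density point. -/
theorem ae_volume_diff_le {E : Set ℝ} (hE : MeasurableSet E) :
    ∀ᵐ t : ℝ, t ∈ E → ∀ η > 0, ∃ ρ > 0, ∀ u v, FineAt (fun _ => ρ) u t v →
      volume.real (Icc u v \ E) ≤ η * (v - u) := by
  set g : ℝ → ℝ := Eᶜ.indicator fun _ => 1 with hg
  have hgi : LocallyIntegrable g volume :=
    (locallyIntegrable_const (1 : ℝ)).indicator hE.compl
  have hgI (a b : ℝ) : IntervalIntegrable g volume a b :=
    intervalIntegrable_iff.mpr
      ((hgi.integrableOn_isCompact isCompact_uIcc).mono_set uIoc_subset_uIcc)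
  filter_upwards [_root_.LocallyIntegrable.ae_hasDerivAt_integral hgi] with t ht htE η hη
  have hgt : g t = 0 := by simp [hg, htE]
  obtain ⟨ρ, hρ, hinc⟩ := (ht 0).exists_increment_le (hgt.trans_lt hη)
  refine ⟨ρ, hρ, fun u v hf => ?_⟩
  have huv : u ≤ v := hf.1.trans hf.2.1
  refine le_trans (le_of_eq ?_) (hinc u v hf)
  rw [intervalIntegral.integral_interval_sub_left (hgI _ _) (hgI _ _), intervalIntegral.integral_of_le huv, hg,
    setIntegral_indicator hE.compl]
  simp only [integral_const, smul_eq_mul, mul_one, measureReal_restrict_apply_univ]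
  refine measureReal_congr ?_
  exact (Ioc_ae_eq_Icc.symm).inter (ae_eq_refl _)

/-- A nonnegative integrable function is dominated, on fine tagged intervals, by a monotone
function whose total increase is almost its integral. -/
theorem exists_monotone_majorant {f : ℝ → ℝ≥0} (hf : AEMeasurable f)
    (hfi : ∫⁻ x, f x ≠ ∞) {η : ℝ} (hη : 0 < η) :
    ∃ δ : ℝ → ℝ, (∀ t, 0 < δ t) ∧ ∃ H : ℝ → ℝ, Monotone H ∧
      (∀ x, H x ∈ Icc 0 ((∫⁻ x, f x).toReal + η)) ∧
      ∀ u t v, FineAt δ u t v → (v - u) * f t ≤ H v - H u := by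
  obtain ⟨g, hfg, hgc, hgi⟩ := exists_lt_lowerSemicontinuous_lintegral_ge_of_aemeasurable
    volume f hf (ENNReal.ofReal_pos.2 hη).ne'
  have hfin : (∫⁻ x, f x) + ENNReal.ofReal η ≠ ∞ :=
    ENNReal.add_ne_top.2 ⟨hfi, ENNReal.ofReal_ne_top⟩
  have hgfin : ∀ s : Set ℝ, ∫⁻ x in s, g x ≠ ∞ := fun s =>
    ((setLIntegral_le_lintegral s g).trans hgi).trans_lt hfin.lt_top |>.ne
  have hex : ∀ t, ∃ ρ > 0, ∀ x, dist x t < ρ → (f t : ℝ≥0∞) < g x := fun t =>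
    Metric.eventually_nhds_iff.1 (hgc t _ (hfg t))
  choose δ hδ hδg using hex
  refine ⟨δ, hδ, fun x => (∫⁻ y in Iic x, g y).toReal, ?_, ?_, ?_⟩
  · intro x y hxy
    exact ENNReal.toReal_mono (hgfin _) (lintegral_mono_set (Iic_subset_Iic.2 hxy))
  · intro x
    refine ⟨ENNReal.toReal_nonneg, ?_⟩
    rw [← ENNReal.toReal_ofReal hη.le, ← ENNReal.toReal_add hfi ENNReal.ofReal_ne_top]
    exact ENNReal.toReal_mono hfin ((setLIntegral_le_lintegral _ g).trans hgi)
  · intro u t v ⟨hut, htv, hu, hv⟩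
    have huv : u ≤ v := hut.trans htv
    have hsplit : ∫⁻ y in Iic v, g y = (∫⁻ y in Iic u, g y) + ∫⁻ y in Ioc u v, g y := by
      rw [← Iic_union_Ioc_eq_Iic huv]
      exact lintegral_union measurableSet_Ioc (Iic_disjoint_Ioc le_rfl)
    beta_reduce
    rw [hsplit, ENNReal.toReal_add (hgfin _) (hgfin _), add_sub_cancel_left]
    have hle : (f t : ℝ≥0∞) * volume (Ioc u v) ≤ ∫⁻ y in Ioc u v, g y := by
      rw [← setLIntegral_const]
      refine setLIntegral_mono' measurableSet_Ioc fun y hy => (hδg t y ?_).le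
      rw [Real.dist_eq, abs_sub_lt_iff]
      constructor <;> linarith [hy.1, hy.2]
    have := ENNReal.toReal_mono (hgfin _) hle
    rw [ENNReal.toReal_mul, Real.volume_Ioc, ENNReal.toReal_ofReal (sub_nonneg.2 huv)] at this
    simpa [mul_comm] using this

/-- A criterion for variational Henstock integrability: the increments of `ψ` are
differentiable with derivative `f` almost everywhere, and are controlled on null sets. -/
theorem fvHIntegrable_of_ae {X : Type*} [NormedAddCommGroup X] [NormedSpace ℝ X]
    {f ψ : ℝ → X} {D : ℝ → ℝ → ℝ → ℝ} (hD : VarNull D) {M : ℝ → ℝ}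
    (hM : ∀ u t v, 0 ≤ u → u ≤ t → t ≤ v → v ≤ 1 →
      ‖ψ v - ψ u - (v - u) • f t‖ ≤ D u t v + (v - u) * M t)
    (hae : ∀ᵐ t : ℝ, t ∈ Icc (0 : ℝ) 1 → ∀ η > 0, ∃ ρ > 0, ∀ u v, 0 ≤ u → v ≤ 1 →
      FineAt (fun _ => ρ) u t v → ‖ψ v - ψ u - (v - u) • f t‖ ≤ η * (v - u)) :
    FvHIntegrable f := by
  classical
  refine ⟨fun a b => ψ b - ψ a, fun a b c _ _ _ _ => (sub_add_sub_cancel' _ _ _).symm, fun ε hε => ?_⟩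
  have hε4 : 0 < ε / 4 := by positivity
  obtain ⟨δ₁, hδ₁, W, hWm, hWb, hW⟩ := hD (ε / 4) hε4
  set G : Set ℝ := {t | ∃ ρ > 0, ∀ u v, 0 ≤ u → v ≤ 1 →
      FineAt (fun _ => ρ) u t v → ‖ψ v - ψ u - (v - u) • f t‖ ≤ ε / 4 * (v - u)} with hG
  set N : Set ℝ := {t | ¬(t ∈ Icc (0 : ℝ) 1 → t ∈ G)} with hN
  have hN0 : volume N = 0 := by
    filter_upwards [hae] with t ht ht01 using ht ht01 _ hε4
  set g : ℝ → ℝ≥0 := N.indicator fun t => (M t).toNNReal with hg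
  have hg0 : g =ᵐ[volume] 0 := indicator_meas_zero hN0
  have hgi : ∫⁻ x, (g x : ℝ≥0∞) = 0 := by
    rw [lintegral_congr_ae (g := fun _ => 0) (hg0.mono fun x hx => by simp [hx])]
    simp
  obtain ⟨δ₂, hδ₂, H, hHm, hHb, hH⟩ := exists_monotone_majorant
    (aemeasurable_const.congr hg0.symm) (hgi ▸ ENNReal.zero_ne_top) hε4
  have hex : ∀ t, ∃ ρ > 0, t ∈ G → ∀ u v, 0 ≤ u → v ≤ 1 →
      FineAt (fun _ => ρ) u t v → ‖ψ v - ψ u - (v - u) • f t‖ ≤ ε / 4 * (v - u) := by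
    intro t
    by_cases ht : t ∈ G
    · obtain ⟨ρ, hρ, h⟩ := ht
      exact ⟨ρ, hρ, fun _ => h⟩
    · exact ⟨1, one_pos, fun h => absurd h ht⟩
  choose δ₃ hδ₃ hf₃ using hex
  refine ⟨fun t => min (δ₁ t) (min (δ₂ t) (δ₃ t)),
    fun t _ => lt_min (hδ₁ t) (lt_min (hδ₂ t) (hδ₃ t)), fun n P hP hfine => ?_⟩
  set T : ℝ → ℝ := fun x => W x + H x + ε / 4 * x with hT
  have hpt : ∀ i, P.pt i ∈ Icc (0 : ℝ) 1 := fun i =>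
    ⟨P.first ▸ P.mono (Fin.zero_le i), P.last ▸ P.mono (Fin.le_last i)⟩
  have hpiece : ∀ i : Fin n, ‖ψ (P.pt i.succ) - ψ (P.pt i.castSucc) - P.len i • f (P.tag i)‖ ≤
      T (P.pt i.succ) - T (P.pt i.castSucc) := by
    intro i
    obtain ⟨hut, htv⟩ := hP i
    set u := P.pt i.castSucc
    set v := P.pt i.succ
    set t := P.tag i with ht
    have huv : u ≤ v := hut.trans htv
    have h0 : 0 ≤ u := (hpt _).1
    have h1 : v ≤ 1 := (hpt _).2
    have hf : FineAt (fun t => min (δ₁ t) (min (δ₂ t) (δ₃ t))) u t v :=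
      ⟨hut, htv, (hfine i (left_mem_Icc.2 huv)).1, (hfine i (right_mem_Icc.2 huv)).2⟩
    have hWuv := hWm huv
    have hHuv := hHm huv
    show ‖ψ v - ψ u - (v - u) • f t‖ ≤ T v - T u
    simp only [hT]
    by_cases htG : t ∈ G
    · have := hf₃ t htG u v h0 h1
        (hf.mono (δ' := fun _ => δ₃ t) ((min_le_right _ _).trans (min_le_right _ _)))
      linarith
    · have htN : t ∈ N := fun h => htG (h (P.tagMem i))
      have h2 := hM u t v h0 hut htv h1
      have h3 := hW u t v h0 h1 (hf.mono (min_le_left _ _))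
      have h4 := hH u t v (hf.mono ((min_le_right _ _).trans (min_le_left _ _)))
      have h5 : (v - u) * M t ≤ (v - u) * g t := by
        refine mul_le_mul_of_nonneg_left ?_ (sub_nonneg.2 huv)
        simp [hg, htN]
      have h6 : 0 ≤ ε / 4 * (v - u) := mul_nonneg hε4.le (sub_nonneg.2 huv)
      linarith
  have htel : ∑ i : Fin n, (T (P.pt i.succ) - T (P.pt i.castSucc)) = T 1 - T 0 := by
    have h1 := Fin.sum_univ_succ fun i => T (P.pt i)
    have h2 := Fin.sum_univ_castSucc fun i => T (P.pt i)
    rw [P.first] at h1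
    rw [P.last] at h2
    rw [Finset.sum_sub_distrib]
    linarith
  refine (Finset.sum_le_sum fun i _ => hpiece i).trans_lt ?_
  rw [htel]
  simp only [hT]
  have h1 := hWb 0
  have h2 := hWb 1
  have h3 := hHb 0
  have h4 := hHb 1
  rw [hgi, ENNReal.toReal_zero] at h3 h4
  linarith [h1.1, h2.2, h3.1, h4.2]

/-! ### Weakly compact sets and support functions -/

theorem continuous_weakSpace_dual (x' : X →L[ℝ] ℝ) :
    Continuous fun x : WeakSpace ℝ X => x' ((toWeakSpace ℝ X).symm x) :=
  WeakBilin.eval_continuous (topDualPairing ℝ X).flip x'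

theorem IsCWK.isClosed {A : Set X} (hA : IsCWK X A) : IsClosed A := by
  have h := hA.2.2.isClosed.preimage (toWeakSpaceCLM ℝ X).continuous
  have h2 : (toWeakSpaceCLM ℝ X) ⁻¹' (toWeakSpace ℝ X '' A) = A :=
    preimage_image_eq A (toWeakSpace ℝ X).injective
  rwa [h2] at h

theorem IsCWK.isBounded {A : Set X} (hA : IsCWK X A) : Bornology.IsBounded A := by
  have hpt : ∀ x' : StrongDual ℝ X, ∃ C, ∀ a : A,
      ‖NormedSpace.inclusionInDoubleDualLi ℝ (a : X) x'‖ ≤ C := by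
    intro x'
    have hc := (hA.2.2.image (continuous_weakSpace_dual x')).isBounded
    obtain ⟨C, hC⟩ := hc.exists_norm_le
    refine ⟨C, fun a => hC _ ?_⟩
    exact ⟨toWeakSpace ℝ X a, mem_image_of_mem _ a.2, rfl⟩
  obtain ⟨C, hC⟩ := banach_steinhaus hpt
  refine isBounded_iff_forall_norm_le.2 ⟨C, fun x hx => ?_⟩
  exact ((NormedSpace.inclusionInDoubleDualLi ℝ).norm_map x).symm.trans_le (hC ⟨x, hx⟩)

theorem bddAbove_image_dual {A : Set X} (hA : Bornology.IsBounded A) (x' : X →L[ℝ] ℝ) :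
    BddAbove (x' '' A) :=
  (x'.lipschitz.isBounded_image hA).bddAbove

theorem le_suppFn {A : Set X} (hA : Bornology.IsBounded A) (x' : X →L[ℝ] ℝ) {x : X}
    (hx : x ∈ A) : x' x ≤ suppFn x' A :=
  le_csSup (bddAbove_image_dual hA x') (mem_image_of_mem _ hx)

theorem suppFn_le {A : Set X} (hA : A.Nonempty) {x' : X →L[ℝ] ℝ} {r : ℝ}
    (h : ∀ x ∈ A, x' x ≤ r) : suppFn x' A ≤ r :=
  csSup_le (hA.image _) (by rintro _ ⟨x, hx, rfl⟩; exact h x hx)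

theorem suppFn_add {A B : Set X} (hA : IsCWK X A) (hB : IsCWK X B) (x' : X →L[ℝ] ℝ) :
    suppFn x' (A + B) = suppFn x' A + suppFn x' B := by
  rw [suppFn, image_add, csSup_add (hA.1.image _) (bddAbove_image_dual hA.isBounded x')
    (hB.1.image _) (bddAbove_image_dual hB.isBounded x')]
  rfl

theorem suppFn_smul {c : ℝ} (hc : 0 ≤ c) (A : Set X) (x' : X →L[ℝ] ℝ) :
    suppFn x' (c • A) = c * suppFn x' A := by
  have : x' '' (c • A) = c • (x' '' A) := by
    simp only [← image_smul, image_image, map_smul]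
  rw [suppFn, this, Real.sSup_smul_of_nonneg hc]
  rfl

theorem suppFn_sub_le_hausdorffDist {A B : Set X} (hA : A.Nonempty) (hB : B.Nonempty)
    (hbA : Bornology.IsBounded A) (hbB : Bornology.IsBounded B) {x' : X →L[ℝ] ℝ}
    (hx' : ‖x'‖ ≤ 1) : suppFn x' A - suppFn x' B ≤ hausdorffDist A B := by
  have hfin := hausdorffEDist_ne_top_of_nonempty_of_bounded hA hB hbA hbB
  refine le_of_forall_pos_le_add fun η hη => ?_
  suffices suppFn x' A ≤ suppFn x' B + (hausdorffDist A B + η) by linarith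
  refine suppFn_le hA fun x hx => ?_
  obtain ⟨y, hy, hxy⟩ := exists_dist_lt_of_hausdorffDist_lt hx
    (lt_add_of_pos_right (hausdorffDist A B) hη) hfin
  have h1 := le_suppFn hbB x' hy
  have h2 : x' (x - y) ≤ 1 * ‖x - y‖ := (le_abs_self _).trans (x'.le_of_opNorm_le hx' _)
  rw [map_sub, ← dist_eq_norm] at h2
  linarith

theorem abs_suppFn_sub_le_hausdorffDist {A B : Set X} (hA : A.Nonempty) (hB : B.Nonempty)
    (hbA : Bornology.IsBounded A) (hbB : Bornology.IsBounded B) {x' : X →L[ℝ] ℝ}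
    (hx' : ‖x'‖ ≤ 1) : |suppFn x' A - suppFn x' B| ≤ hausdorffDist A B := by
  refine abs_sub_le_iff.2 ⟨suppFn_sub_le_hausdorffDist hA hB hbA hbB hx', ?_⟩
  rw [hausdorffDist_comm]
  exact suppFn_sub_le_hausdorffDist hB hA hbB hbA hx'

theorem norm_le_of_forall_dual_le {x : X} {r : ℝ}
    (h : ∀ x' : X →L[ℝ] ℝ, ‖x'‖ ≤ 1 → x' x ≤ r) : ‖x‖ ≤ r := by
  obtain ⟨x', hx', hxx⟩ := exists_dual_vector'' ℝ x
  have := h x' hx'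
  rw [hxx] at this
  simpa using this

theorem zero_mem_of_eq_add_self {A : Set X} (hne : A.Nonempty) (hb : Bornology.IsBounded A)
    (h : A = A + A) : (0 : X) ∈ A := by
  obtain ⟨x, hx⟩ := hne
  have hpow : ∀ n : ℕ, (2 ^ n : ℝ) • x ∈ A := by
    intro n
    induction n with
    | zero => simpa
    | succ n ih =>
      rw [h]
      convert add_mem_add ih ih using 1
      rw [← two_smul ℝ ((2 ^ n : ℝ) • x), smul_smul, pow_succ']
  obtain ⟨C, hC⟩ := hb.exists_norm_le
  have hx0 : x = 0 := by
    by_contra hx0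
    have hpos : 0 < ‖x‖ := norm_pos_iff.2 hx0
    obtain ⟨n, hn⟩ := pow_unbounded_of_one_lt (C / ‖x‖) one_lt_two
    have h1 := hC _ (hpow n)
    rw [norm_smul, norm_pow, Real.norm_ofNat] at h1
    rw [div_lt_iff₀ hpos] at hn
    linarith
  exact hx0 ▸ hx

/-- A net approaching a weakly compact set has a weakly convergent subnet. -/
theorem IsCWK.exists_weak_limit {A : Set X} (hA : IsCWK X A) {ι : Type*} (U : Ultrafilter ι)
    {S : ι → X} (hS : Tendsto (fun i => infDist (S i) A) U (𝓝 0)) :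
    ∃ y, ∀ x' : X →L[ℝ] ℝ, Tendsto (fun i => x' (S i)) U (𝓝 (x' y)) := by
  have hex : ∀ i, ∃ y ∈ A, dist (S i) y ≤ 2 * infDist (S i) A := by
    intro i
    rcases infDist_nonneg.eq_or_lt' (a := infDist (S i) A) with h0 | hpos
    · exact ⟨S i, (hA.isClosed.mem_iff_infDist_zero hA.1).2 h0, by simp [h0]⟩
    · obtain ⟨y, hy, hlt⟩ := (infDist_lt_iff hA.1).1 (lt_two_mul_self hpos)
      exact ⟨y, hy, hlt.le⟩
  choose y hyA hy using hex
  have hmem : ∀ i, toWeakSpace ℝ X (y i) ∈ toWeakSpace ℝ X '' A :=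
    fun i => mem_image_of_mem _ (hyA i)
  obtain ⟨_, ⟨z, hz, rfl⟩, hlim⟩ := hA.2.2.ultrafilter_le_nhds
    (U.map fun i => toWeakSpace ℝ X (y i))
    (le_principal_iff.2 (Filter.mem_map.2 (univ_mem' hmem)))
  refine ⟨z, fun x' => ?_⟩
  have h1 : Tendsto (fun i => x' (y i)) U (𝓝 (x' z)) := by
    have h2 : Tendsto (fun i => toWeakSpace ℝ X (y i)) U (𝓝 (toWeakSpace ℝ X z)) := hlim
    have h3 := ((continuous_weakSpace_dual x').tendsto _).comp h2
    exact h3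
  have h2 : Tendsto (fun i => S i - y i) U (𝓝 0) := by
    refine squeeze_zero_norm (fun i => ?_) (by simpa using hS.const_mul 2)
    rw [← dist_eq_norm]
    exact hy i
  have h3 := ((x'.continuous.tendsto 0).comp h2).add h1
  simpa using h3

/-! ### Primitives of selections -/

theorem vHPrimitive.varNull {Γ : ℝ → Set X} {Φ : ℝ → ℝ → Set X} (h : vHPrimitive Γ Φ) :
    VarNull fun u t v => hausdorffDist (Φ u v) ((v - u) • Γ t) := by
  refine varNull_of_chain_sum_le (fun _ _ _ => hausdorffDist_nonneg) fun ε hε => ?_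
  obtain ⟨δ, hδ, hsum⟩ := h.2.2 ε hε
  classical
  set δ' : ℝ → ℝ := fun t => if t ∈ Icc (0 : ℝ) 1 then δ t else 1 with hδ'
  refine ⟨δ', fun t => ?_, fun l hl => ?_⟩
  · by_cases ht : t ∈ Icc (0 : ℝ) 1
    · simpa only [hδ', if_pos ht] using hδ t ht
    · simp only [hδ', if_neg ht, zero_lt_one]
  · obtain ⟨n, pt, tag, h0, h1, hf, hl⟩ := hl.exists_fin
    have hmono : Monotone pt := Fin.monotone_iff_le_succ.2 fun i => (hf i).1.trans (hf i).2.1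
    have htag : ∀ i, tag i ∈ Icc (0 : ℝ) 1 := fun i =>
      ⟨h0.symm.le.trans ((hmono (Fin.zero_le _)).trans (hf i).1),
        ((hf i).2.1.trans (hmono (Fin.le_last _))).trans h1.le⟩
    rw [← hl fun u t v => hausdorffDist (Φ u v) ((v - u) • Γ t)]
    refine (hsum n ⟨pt, tag, hmono, h0, h1, htag⟩ (fun i => ⟨(hf i).1, (hf i).2.1⟩)
      fun i x hx => ?_).le
    have h2 := (hf i).2.2
    simp only [hδ', if_pos (htag i)] at h2
    exact ⟨h2.1.trans_le hx.1, hx.2.trans_lt h2.2⟩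

theorem infDist_add_le {Y : Type*} [SeminormedAddCommGroup Y] {A B : Set Y} (hA : A.Nonempty) (hB : B.Nonempty)
    (x y : Y) :
    infDist (x + y) (A + B) ≤ infDist x A + infDist y B := by
  refine le_of_forall_pos_le_add fun η hη => ?_
  obtain ⟨a, ha, hxa⟩ := (infDist_lt_iff hA).1 (lt_add_of_pos_right (infDist x A) (half_pos hη))
  obtain ⟨b, hb, hyb⟩ := (infDist_lt_iff hB).1 (lt_add_of_pos_right (infDist y B) (half_pos hη))
  have := infDist_le_dist_of_mem (x := x + y) (add_mem_add ha hb)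
  linarith [dist_add_add_le x y a b]

/-- The Riemann sum of `f` over a list of tagged intervals. -/
def riemannSum (f : ℝ → X) (l : List (ℝ × ℝ × ℝ)) : X :=
  (l.map fun p => (p.2.2 - p.1) • f p.2.1).sum

/-- The Riemann sum of `f` over a list of tagged intervals, cut off at `x`. -/
noncomputable def cutSum (f : ℝ → X) (x : ℝ) (l : List (ℝ × ℝ × ℝ)) : X :=
  (l.map fun p => (min p.2.2 x - min p.1 x) • f p.2.1).sum

theorem FineAt.clamp {δ : ℝ → ℝ} {u t v a b : ℝ} (ha : t ≠ a → δ t ≤ |t - a|)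
    (hb : t ≠ b → δ t ≤ |t - b|) (h : FineAt δ u t v) :
    max a (min u b) = max a (min v b) ∨ FineAt δ (max a (min u b)) t (max a (min v b)) := by
  obtain ⟨hut, htv, hu, hv⟩ := h
  rcases lt_or_ge t a with hta | hta
  · have := ha hta.ne
    rw [abs_of_neg (sub_neg.2 hta)] at this
    left
    rw [max_eq_left ((min_le_left _ _).trans (by linarith)),
      max_eq_left ((min_le_left _ _).trans (by linarith))]
  rcases lt_or_ge b t with hbt | hbt
  · have := hb hbt.ne'
    rw [abs_of_pos (sub_pos.2 hbt)] at this
    left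
    rw [min_eq_right (by linarith), min_eq_right (by linarith)]
  · right
    refine ⟨max_le hta ((min_le_left _ _).trans hut), (le_min htv hbt).trans (le_max_right _ _),
      hu.trans_le ((le_min le_rfl (hut.trans hbt)).trans (le_max_right _ _)),
      (max_le (hta.trans htv) (min_le_left _ _)).trans_lt hv⟩

theorem min_sub_min_eq {a b x y : ℝ} (hab : a ≤ b) :
    (min x b - min y b) - (min x a - min y a) = max a (min x b) - max a (min y b) := by
  have key : ∀ z, min z b - min z a = max a (min z b) - a := by
    intro z
    rcases le_total z a with h | h
    · rw [min_eq_left h, min_eq_left (h.trans hab), max_eq_left h]; ring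
    · rw [min_eq_right h, max_eq_right (le_min h hab)]
  linarith [key x, key y]

/-- If the gauge forces `a` and `b` to be tags, a fine chain restricts to a fine chain on
`[a, b]`. -/
theorem Chain.exists_restrict {δ : ℝ → ℝ} {a b : ℝ} (hab : a ≤ b)
    (ha : ∀ t ≠ a, δ t ≤ |t - a|) (hb : ∀ t ≠ b, δ t ≤ |t - b|) (f : ℝ → X) {c d : ℝ}
    {l : List (ℝ × ℝ × ℝ)} (h : Chain δ c d l) :
    ∃ l', Chain δ (max a (min c b)) (max a (min d b)) l' ∧
      riemannSum f l' = cutSum f b l - cutSum f a l := by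
  induction h with
  | nil c => exact ⟨[], .nil _, by simp [riemannSum, cutSum]⟩
  | @cons u t v d l hf hl ih =>
    obtain ⟨l', hl', hsum⟩ := ih
    have hcons : cutSum f b ((u, t, v) :: l) - cutSum f a ((u, t, v) :: l) =
        (max a (min v b) - max a (min u b)) • f t + riemannSum f l' := by
      rw [hsum, ← min_sub_min_eq hab, sub_smul]
      simp only [cutSum, List.map_cons, List.sum_cons]
      abel
    rcases hf.clamp (ha t) (hb t) with heq | hf'
    · refine ⟨l', heq ▸ hl', ?_⟩
      rw [hcons, heq, sub_self, zero_smul, zero_add]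
    · refine ⟨_, .cons hf' hl', ?_⟩
      rw [hcons]
      simp [riemannSum]

/-- The filter of fine tagged Perron partitions of `[0,1]`. -/
def fineFilter : Filter (List (ℝ × ℝ × ℝ)) :=
  ⨅ δ : {δ : ℝ → ℝ // ∀ t, 0 < δ t}, 𝓟 {l | Chain δ.1 0 1 l}

theorem chain_mem_fineFilter {δ : ℝ → ℝ} (hδ : ∀ t, 0 < δ t) :
    ∀ᶠ l in fineFilter, Chain δ 0 1 l :=
  mem_iInf_of_mem (⟨δ, hδ⟩ : {δ : ℝ → ℝ // ∀ t, 0 < δ t}) (mem_principal_self _)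

instance fineFilter_neBot : fineFilter.NeBot := by
  have : Nonempty {δ : ℝ → ℝ // ∀ t, 0 < δ t} := ⟨⟨fun _ => 1, fun _ => one_pos⟩⟩
  refine iInf_neBot_of_directed ?_ fun δ => principal_neBot_iff.2
    (Chain.exists_chain δ.2 zero_le_one)
  intro δ₁ δ₂
  refine ⟨⟨fun t => min (δ₁.1 t) (δ₂.1 t), fun t => lt_min (δ₁.2 t) (δ₂.2 t)⟩, ?_, ?_⟩
  · exact principal_mono.2 fun l hl => Chain.mono (fun t => min_le_left _ _) hl
  · exact principal_mono.2 fun l hl => Chain.mono (fun t => min_le_right _ _) hl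

theorem exists_gauge_forcing (a : ℝ) :
    ∃ δ : ℝ → ℝ, (∀ t, 0 < δ t) ∧ ∀ t ≠ a, δ t ≤ |t - a| := by
  classical
  refine ⟨fun t => if t = a then 1 else |t - a|, fun t => ?_, fun t ht => by simp [ht]⟩
  by_cases ht : t = a
  · simp [ht]
  · simpa [ht] using sub_ne_zero.2 ht

theorem eventually_exists_restrict {δ : ℝ → ℝ} (hδ : ∀ t, 0 < δ t) {a b : ℝ} (ha : 0 ≤ a)
    (hab : a ≤ b) (hb : b ≤ 1) (f : ℝ → X) :
    ∀ᶠ l in fineFilter, ∃ l', Chain δ a b l' ∧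
      riemannSum f l' = cutSum f b l - cutSum f a l := by
  obtain ⟨δa, hδa, hfa⟩ := exists_gauge_forcing a
  obtain ⟨δb, hδb, hfb⟩ := exists_gauge_forcing b
  have hpos : ∀ t, 0 < min (δ t) (min (δa t) (δb t)) := fun t =>
    lt_min (hδ t) (lt_min (hδa t) (hδb t))
  filter_upwards [chain_mem_fineFilter hpos] with l hl
  obtain ⟨l', hl', hsum⟩ := hl.exists_restrict hab
    (fun t ht => ((min_le_right _ _).trans (min_le_left _ _)).trans (hfa t ht))
    (fun t ht => ((min_le_right _ _).trans (min_le_right _ _)).trans (hfb t ht)) f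
  rw [min_eq_left (ha.trans hab), max_eq_left ha, min_eq_right hb, max_eq_right hab] at hl'
  exact ⟨l', hl'.mono fun t => min_le_left _ _, hsum⟩

theorem Chain.infDist_riemannSum_le {Γ : ℝ → Set X} {Φ : ℝ → ℝ → Set X}
    (hΓ : ∀ t ∈ Icc (0 : ℝ) 1, IsCWK X (Γ t)) (h : vHPrimitive Γ Φ) {f : ℝ → X}
    (hsel : Selection Γ f) {δ W : ℝ → ℝ}
    (hW : ∀ u t v, 0 ≤ u → v ≤ 1 → FineAt δ u t v →
      hausdorffDist (Φ u v) ((v - u) • Γ t) ≤ W v - W u) {a b : ℝ} {l : List (ℝ × ℝ × ℝ)}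
    (hl : Chain δ a b l) (ha : 0 ≤ a) (hb : b ≤ 1) :
    infDist (riemannSum f l) (Φ a b) ≤ W b - W a := by
  induction hl with
  | nil a =>
    have hcwk := h.1 a a ha le_rfl hb
    have h0 := zero_mem_of_eq_add_self hcwk.1 hcwk.isBounded
      (h.2.1 a a a ha le_rfl le_rfl hb)
    simp [riemannSum, infDist_zero_of_mem h0]
  | @cons u t v b l hf hl ih =>
    have huv : u ≤ v := hf.1.trans hf.2.1
    have ht : t ∈ Icc (0 : ℝ) 1 := ⟨ha.trans hf.1, hf.2.1.trans (hl.le.trans hb)⟩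
    have hΦ := h.1 u v ha huv (hl.le.trans hb)
    have h1 : infDist ((v - u) • f t) (Φ u v) ≤ W v - W u := by
      refine le_trans ?_ (hW u t v ha (hl.le.trans hb) hf)
      rw [hausdorffDist_comm]
      refine infDist_le_hausdorffDist_of_mem (smul_mem_smul_set (hsel t ht)) ?_
      exact hausdorffEDist_ne_top_of_nonempty_of_bounded ((hΓ t ht).1.smul_set) hΦ.1
        ((hΓ t ht).isBounded.smul₀ _) hΦ.isBounded
    have h2 := ih (ha.trans huv) hb
    have h3 := infDist_add_le hΦ.1 (h.1 v b (ha.trans huv) hl.le hb).1 ((v - u) • f t)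
      (riemannSum f l)
    rw [h.2.1 u v b ha huv hl.le hb]
    have h4 : riemannSum f ((u, t, v) :: l) = (v - u) • f t + riemannSum f l := by
      simp [riemannSum]
    rw [h4]
    linarith

/-- The selection `f` has a weak primitive, whose increments are weakly controlled by the
Riemann sums of `f` over sufficiently fine partitions. -/
theorem vHPrimitive.exists_weak_primitive {Γ : ℝ → Set X} {Φ : ℝ → ℝ → Set X}
    (hΓ : ∀ t ∈ Icc (0 : ℝ) 1, IsCWK X (Γ t)) (h : vHPrimitive Γ Φ) {f : ℝ → X}
    (hsel : Selection Γ f) :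
    ∃ ψ : ℝ → X, ∀ (x' : X →L[ℝ] ℝ) (a b : ℝ), 0 ≤ a → a ≤ b → b ≤ 1 →
      ∀ (δ : ℝ → ℝ) (C : ℝ), (∀ t, 0 < δ t) →
        (∀ l, Chain δ a b l → x' (riemannSum f l) ≤ C) → x' (ψ b - ψ a) ≤ C := by
  set U := Ultrafilter.of fineFilter with hU
  have hUle : (U : Filter _) ≤ fineFilter := Ultrafilter.of_le _
  have hex : ∀ x : ℝ, ∃ y : X, x ∈ Icc (0 : ℝ) 1 → ∀ x' : X →L[ℝ] ℝ,
      Tendsto (fun l => x' (cutSum f x l - cutSum f 0 l)) U (𝓝 (x' y)) := by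
    intro x
    by_cases hx : x ∈ Icc (0 : ℝ) 1
    swap
    · exact ⟨0, fun hx' => absurd hx' hx⟩
    have hlim : Tendsto (fun l => infDist (cutSum f x l - cutSum f 0 l) (Φ 0 x)) U (𝓝 0) := by
      rw [Metric.tendsto_nhds]
      intro ε hε
      obtain ⟨δ, hδ, W, -, hWb, hW⟩ := h.varNull (ε / 2) (half_pos hε)
      refine hUle ?_
      filter_upwards [eventually_exists_restrict hδ le_rfl hx.1 hx.2 f] with l hl
      obtain ⟨l', hl', hsum⟩ := hl
      rw [← hsum, Real.dist_eq, sub_zero, abs_of_nonneg infDist_nonneg]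
      have := hl'.infDist_riemannSum_le hΓ h hsel hW le_rfl hx.2
      linarith [(hWb 0).1, (hWb x).2]
    obtain ⟨y, hy⟩ := (h.1 0 x le_rfl hx.1 hx.2).exists_weak_limit U hlim
    exact ⟨y, fun _ => hy⟩
  choose ψ hψ using hex
  refine ⟨ψ, fun x' a b ha hab hb δ C hδ hC => ?_⟩
  have hlim := (hψ b ⟨ha.trans hab, hb⟩ x').sub (hψ a ⟨ha, hab.trans hb⟩ x')
  rw [map_sub]
  refine le_of_tendsto hlim (hUle ?_)
  filter_upwards [eventually_exists_restrict hδ ha hab hb f] with l hl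
  obtain ⟨l', hl', hsum⟩ := hl
  have := hC l' hl'
  rwa [hsum, ← sub_sub_sub_cancel_right _ _ (cutSum f 0 l), map_sub] at this

theorem vHPrimitive.abs_suppFn_sub_le {Γ : ℝ → Set X} {Φ : ℝ → ℝ → Set X}
    (hΓ : ∀ t ∈ Icc (0 : ℝ) 1, IsCWK X (Γ t)) (h : vHPrimitive Γ Φ) {x' : X →L[ℝ] ℝ}
    (hx' : ‖x'‖ ≤ 1) {u t v : ℝ} (hu : 0 ≤ u) (hut : u ≤ t) (htv : t ≤ v) (hv : v ≤ 1) :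
    |suppFn x' (Φ u v) - (v - u) * suppFn x' (Γ t)| ≤
      hausdorffDist (Φ u v) ((v - u) • Γ t) := by
  have ht := hΓ t ⟨hu.trans hut, htv.trans hv⟩
  have hΦ := h.1 u v hu (hut.trans htv) hv
  rw [← suppFn_smul (sub_nonneg.2 (hut.trans htv))]
  exact abs_suppFn_sub_le_hausdorffDist hΦ.1 ht.1.smul_set hΦ.isBounded
    (ht.isBounded.smul₀ _) hx'

/-- An interval `[a, b]` on most of which `f` and `Γ` are nearly constant yields a small
increment of `ψ` relative to `f t`. -/
theorem norm_sub_smul_le_of_nearly_constant {Γ : ℝ → Set X} {Φ : ℝ → ℝ → Set X}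
    (hΓ : ∀ t ∈ Icc (0 : ℝ) 1, IsCWK X (Γ t)) (h : vHPrimitive Γ Φ) {f ψ : ℝ → X}
    (hsel : Selection Γ f)
    (hψ : ∀ (x' : X →L[ℝ] ℝ) (a b : ℝ), 0 ≤ a → a ≤ b → b ≤ 1 →
      ∀ (δ : ℝ → ℝ) (C : ℝ), (∀ t, 0 < δ t) →
        (∀ l, Chain δ a b l → x' (riemannSum f l) ≤ C) → x' (ψ b - ψ a) ≤ C)
    {E : Set ℝ} (hE : MeasurableSet E) {t ε M a b : ℝ} (ht : t ∈ Icc a b) (ha : 0 ≤ a)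
    (hb : b ≤ 1) (hfE : ∀ s ∈ E, ‖f s - f t‖ ≤ ε)
    (hΓE : ∀ s ∈ E, ∀ x' : X →L[ℝ] ℝ, ‖x'‖ ≤ 1 → suppFn x' (Γ t) ≤ suppFn x' (Γ s) + ε)
    (hε : 0 ≤ ε) (hM : ∀ x ∈ Γ t, ‖x‖ ≤ M) :
    ‖ψ b - ψ a - (b - a) • f t‖ ≤ hausdorffDist (Φ a b) ((b - a) • Γ t) + 2 * ε * (b - a) +
      2 * M * volume.real (Icc a b \ E) := by
  have hab : a ≤ b := ht.1.trans ht.2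
  have ht01 : t ∈ Icc (0 : ℝ) 1 := ⟨ha.trans ht.1, ht.2.trans hb⟩
  have hM0 : 0 ≤ M := (norm_nonneg _).trans (hM _ (hsel t ht01))
  refine norm_le_of_forall_dual_le fun x' hx' => ?_
  set σ : ℝ → ℝ → ℝ := fun u v => suppFn x' (Φ u v) with hσ
  have hσadd : ∀ u v, 0 ≤ u → u ≤ v → v ≤ 1 → σ u v = σ 0 v - σ 0 u := by
    intro u v hu huv hv
    have := suppFn_add (h.1 0 u le_rfl hu (huv.trans hv)) (h.1 u v hu huv hv) x'
    rw [← h.2.1 0 u v le_rfl hu huv hv] at this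
    simp only [hσ]
    linarith
  have hxle : ∀ x, x' x ≤ ‖x‖ := fun x =>
    (le_abs_self _).trans ((x'.le_of_opNorm_le hx' x).trans_eq (one_mul _))
  set τ := x' (f t) - suppFn x' (Γ t) with hτ
  have hτM : -(2 * M) ≤ τ := by
    have h1 : suppFn x' (Γ t) ≤ M :=
      suppFn_le (hΓ t ht01).1 fun x hx => (hxle x).trans (hM x hx)
    have h2 := (hxle (-f t)).trans ((norm_neg _).le.trans (hM _ (hsel t ht01)))
    rw [map_neg] at h2
    linarith
  set B := Icc a b \ E with hB
  have hBm : MeasurableSet B := measurableSet_Icc.diff hE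
  have hBfin : volume B ≠ ∞ := measure_ne_top_of_subset sdiff_subset (by simp)
  have hind : ∫⁻ x, ((B.indicator (fun _ => 1) x : ℝ≥0) : ℝ≥0∞) = volume B := by
    rw [← lintegral_indicator_one hBm]
    congr 1
    ext x
    by_cases hx : x ∈ B <;> simp [hx]
  have key : ∀ η > 0, x' (ψ b - ψ a) ≤ (b - a) * x' (f t) +
      (hausdorffDist (Φ a b) ((b - a) • Γ t) + 2 * ε * (b - a) + 2 * M * volume.real B) +
      (1 + 2 * M) * η := by
    intro η hη
    obtain ⟨δ₁, hδ₁, W, hW, hWb, hWD⟩ := h.varNull η hη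
    obtain ⟨δ₂, hδ₂, H, hH, hHb, hHD⟩ := exists_monotone_majorant
      (f := B.indicator fun _ => 1) (measurable_const.indicator hBm).aemeasurable
      (hind ▸ hBfin) hη
    rw [hind] at hHb
    refine hψ x' a b ha hab hb (fun s => min (δ₁ s) (δ₂ s)) _
      (fun s => lt_min (hδ₁ s) (hδ₂ s)) fun l hl => ?_
    have hsum := hl.sum_le (D := fun u s v => (v - u) * x' (f s))
      (W := fun x => σ 0 x + W x + 2 * M * H x + (τ + 2 * ε) * x) ?_
    · have hsum' : x' (riemannSum f l) = (l.map fun p => (p.2.2 - p.1) * x' (f p.2.1)).sum := by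
        rw [riemannSum, map_list_sum, List.map_map]
        simp [Function.comp_def]
      rw [hsum']
      refine hsum.trans ?_
      have h1 : σ a b - (b - a) * suppFn x' (Γ t) ≤ _ :=
        (abs_le.1 (h.abs_suppFn_sub_le hΓ hx' ha ht.1 ht.2 hb)).2
      rw [hσadd a b ha hab hb] at h1
      have h2 : 2 * M * H b ≤ 2 * M * (volume.real B + η) :=
        mul_le_mul_of_nonneg_left (hHb b).2 (by linarith)
      have h3 : 0 ≤ 2 * M * H a := mul_nonneg (by linarith) (hHb a).1
      have h4 := (hWb b).2
      have h5 := (hWb a).1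
      simp only [hτ]
      linarith
    · intro u s v hu hv hf
      have huv : u ≤ v := hf.1.trans hf.2.1
      have hu0 := ha.trans hu
      have hv1 := hv.trans hb
      have hs01 : s ∈ Icc (0 : ℝ) 1 := ⟨hu0.trans hf.1, hf.2.1.trans hv1⟩
      have h1 : -(W v - W u) ≤ σ u v - (v - u) * suppFn x' (Γ s) :=
        (abs_le.1 ((h.abs_suppFn_sub_le hΓ hx' hu0 hf.1 hf.2.1 hv1).trans (hWD u s v hu0 hv1 (hf.mono (min_le_left _ _))))).1
      rw [hσadd u v hu0 huv hv1] at h1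
      have h2 := hHD u s v (hf.mono (min_le_right _ _))
      have hHuv : 0 ≤ 2 * M * (H v - H u) :=
        mul_nonneg (by linarith) (sub_nonneg.2 (hH huv))
      by_cases hsE : s ∈ E
      · have h3 := (hxle _).trans (hfE s hsE)
        rw [map_sub] at h3
        have h4 := hΓE s hsE x' hx'
        have h5 : (v - u) * x' (f s) ≤ (v - u) * (τ + suppFn x' (Γ s) + 2 * ε) :=
          mul_le_mul_of_nonneg_left (by simp only [hτ]; linarith) (sub_nonneg.2 huv)
        linarith
      · have hsB : s ∈ B := ⟨⟨hu.trans hf.1, hf.2.1.trans hv⟩, hsE⟩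
        rw [indicator_of_mem hsB, NNReal.coe_one, mul_one] at h2
        have h3 : (v - u) * x' (f s) ≤ (v - u) * suppFn x' (Γ s) :=
          mul_le_mul_of_nonneg_left (le_suppFn (hΓ s hs01).isBounded x' (hsel s hs01))
            (sub_nonneg.2 huv)
        have h4 : (v - u) * -(2 * M) ≤ (v - u) * τ :=
          mul_le_mul_of_nonneg_left hτM (sub_nonneg.2 huv)
        have h5 : 2 * M * (v - u) ≤ 2 * M * (H v - H u) :=
          mul_le_mul_of_nonneg_left h2 (by linarith)
        have h6 : 0 ≤ 2 * ε * (v - u) := mul_nonneg (by linarith) (sub_nonneg.2 huv)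
        linarith
  have hfinal := le_of_forall_pos_le_add (a := x' (ψ b - ψ a)) (b := (b - a) * x' (f t) +
      (hausdorffDist (Φ a b) ((b - a) • Γ t) + 2 * ε * (b - a) + 2 * M * volume.real B))
    fun η hη => by
      have h1 : 0 < 1 + 2 * M := by linarith
      have := key (η / (1 + 2 * M)) (div_pos hη h1)
      rwa [mul_div_cancel₀ _ h1.ne'] at this
  rw [map_sub x', map_smul, smul_eq_mul]
  linarith

/-! ### Pieces on which a selection is nearly constant -/

/-- `Γ` is the variational derivative of `Φ` at `t`. -/
def IsVarDeriv (Γ : ℝ → Set X) (Φ : ℝ → ℝ → Set X) (t : ℝ) : Prop :=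
  ∀ η > 0, ∃ ρ > 0, ∀ u v, 0 ≤ u → v ≤ 1 → FineAt (fun _ => ρ) u t v →
    hausdorffDist (Φ u v) ((v - u) • Γ t) ≤ η * (v - u)

/-- The points near which the averages of `Φ` at scales below `ρ` oscillate by at most
`2 * ε`. -/
def smallOscillation (Φ : ℝ → ℝ → Set X) (ε ρ : ℝ) : Set ℝ :=
  {t | ∀ x' : X →L[ℝ] ℝ, ‖x'‖ ≤ 1 → ∀ u v u' v', 0 ≤ u → v ≤ 1 → t ∈ Ioo u v → v - u < ρ →
    0 ≤ u' → v' ≤ 1 → t ∈ Ioo u' v' → v' - u' < ρ →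
    suppFn x' (Φ u v) / (v - u) ≤ suppFn x' (Φ u' v') / (v' - u') + 2 * ε}

theorem isClosed_smallOscillation (Φ : ℝ → ℝ → Set X) (ε ρ : ℝ) :
    IsClosed (smallOscillation Φ ε ρ) := by
  rw [← isOpen_compl_iff, isOpen_iff_mem_nhds]
  intro t ht
  simp only [smallOscillation, mem_compl_iff, mem_ofPred_eq, not_forall] at ht
  obtain ⟨x', hx', u, v, u', v', hu, hv, htuv, huv, hu', hv', htuv', huv', hlt⟩ := ht
  filter_upwards [Ioo_mem_nhds htuv.1 htuv.2, Ioo_mem_nhds htuv'.1 htuv'.2] with s hs hs' hsO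
  exact hlt (hsO x' hx' u v u' v' hu hv hs huv hu' hv' hs' huv')

theorem vHPrimitive.abs_suppFn_div_sub_le {Γ : ℝ → Set X} {Φ : ℝ → ℝ → Set X}
    (hΓ : ∀ t ∈ Icc (0 : ℝ) 1, IsCWK X (Γ t)) (h : vHPrimitive Γ Φ) {x' : X →L[ℝ] ℝ}
    (hx' : ‖x'‖ ≤ 1) {u t v η : ℝ} (hu : 0 ≤ u) (hut : u < t) (htv : t < v) (hv : v ≤ 1)
    (hD : hausdorffDist (Φ u v) ((v - u) • Γ t) ≤ η * (v - u)) :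
    |suppFn x' (Φ u v) / (v - u) - suppFn x' (Γ t)| ≤ η := by
  have huv : 0 < v - u := by linarith
  have h1 := (h.abs_suppFn_sub_le hΓ hx' hu hut.le htv.le hv).trans hD
  rw [← mul_div_cancel_left₀ (suppFn x' (Γ t)) huv.ne', ← sub_div, abs_div, abs_of_pos huv,
    div_le_iff₀ huv]
  exact h1

theorem IsVarDeriv.exists_mem_smallOscillation {Γ : ℝ → Set X} {Φ : ℝ → ℝ → Set X}
    (hΓ : ∀ t ∈ Icc (0 : ℝ) 1, IsCWK X (Γ t)) (h : vHPrimitive Γ Φ) {t ε : ℝ}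
    (ht : IsVarDeriv Γ Φ t) (hε : 0 < ε) :
    ∃ n : ℕ, t ∈ smallOscillation Φ ε (1 / ((n : ℝ) + 1)) := by
  obtain ⟨ρ, hρ, hD⟩ := ht ε hε
  obtain ⟨n, hn⟩ := exists_nat_one_div_lt hρ
  have key : ∀ x' : X →L[ℝ] ℝ, ‖x'‖ ≤ 1 → ∀ u v, 0 ≤ u → v ≤ 1 → t ∈ Ioo u v →
      v - u < 1 / ((n : ℝ) + 1) → |suppFn x' (Φ u v) / (v - u) - suppFn x' (Γ t)| ≤ ε :=
    fun x' hx' u v hu hv ht huv => h.abs_suppFn_div_sub_le hΓ hx' hu ht.1 ht.2 hv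
      (hD u v hu hv ⟨ht.1.le, ht.2.le, by linarith [ht.2], by linarith [ht.1]⟩)
  refine ⟨n, fun x' hx' u v u' v' hu hv ht huv hu' hv' ht' huv' => ?_⟩
  have h1 := (abs_le.1 (key x' hx' u v hu hv ht huv)).2
  have h2 := (abs_le.1 (key x' hx' u' v' hu' hv' ht' huv')).1
  linarith

theorem IsVarDeriv.exists_average_near {Γ : ℝ → Set X} {Φ : ℝ → ℝ → Set X}
    (hΓ : ∀ t ∈ Icc (0 : ℝ) 1, IsCWK X (Γ t)) (h : vHPrimitive Γ Φ) {t ε ρ : ℝ}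
    (ht : IsVarDeriv Γ Φ t) (ht01 : t ∈ Ioo (0 : ℝ) 1) (hε : 0 < ε) (hρ : 0 < ρ) :
    ∃ u v, 0 ≤ u ∧ v ≤ 1 ∧ t ∈ Ioo u v ∧ v - u < ρ ∧ ∀ x' : X →L[ℝ] ℝ, ‖x'‖ ≤ 1 →
      |suppFn x' (Φ u v) / (v - u) - suppFn x' (Γ t)| ≤ ε := by
  obtain ⟨ρ', hρ', hD⟩ := ht ε hε
  obtain ⟨ht0, ht1⟩ := ht01
  set r := min (min t (1 - t)) (min (ρ / 4) (ρ' / 2)) with hr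
  have hr0 : 0 < r := by
    refine lt_min (lt_min ht0 (sub_pos.2 ht1)) (lt_min ?_ ?_) <;> linarith
  have hr1 : r ≤ t := (min_le_left _ _).trans (min_le_left _ _)
  have hr2 : r ≤ 1 - t := (min_le_left _ _).trans (min_le_right _ _)
  have hr3 : r ≤ ρ / 4 := (min_le_right _ _).trans (min_le_left _ _)
  have hr4 : r ≤ ρ' / 2 := (min_le_right _ _).trans (min_le_right _ _)
  refine ⟨t - r, t + r, by linarith, by linarith, ⟨by linarith, by linarith⟩, by linarith,
    fun x' hx' => ?_⟩
  exact h.abs_suppFn_div_sub_le hΓ hx' (by linarith) (by linarith) (by linarith) (by linarith)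
    (hD _ _ (by linarith) (by linarith) ⟨by linarith, by linarith, by linarith, by linarith⟩)

theorem suppFn_le_of_smallOscillation {Γ : ℝ → Set X} {Φ : ℝ → ℝ → Set X}
    (hΓ : ∀ t ∈ Icc (0 : ℝ) 1, IsCWK X (Γ t)) (h : vHPrimitive Γ Φ) {s t ε ρ : ℝ}
    (hε : 0 < ε) (hs01 : s ∈ Ioo (0 : ℝ) 1) (ht01 : t ∈ Ioo (0 : ℝ) 1)
    (hs : IsVarDeriv Γ Φ s) (ht : IsVarDeriv Γ Φ t) (hsO : s ∈ smallOscillation Φ ε ρ)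
    (htO : t ∈ smallOscillation Φ ε ρ) (hst : |s - t| < ρ) {x' : X →L[ℝ] ℝ} (hx' : ‖x'‖ ≤ 1) :
    suppFn x' (Γ t) ≤ suppFn x' (Γ s) + 6 * ε := by
  have hρ : 0 < ρ := (abs_nonneg _).trans_lt hst
  obtain ⟨u, v, hu, hv, hsuv, huv, hsx⟩ := hs.exists_average_near hΓ h hs01 hε hρ
  obtain ⟨u', v', hu', hv', htuv, huv', htx⟩ := ht.exists_average_near hΓ h ht01 hε hρ
  obtain ⟨a, b, ha, hb, hsab, htab, hab⟩ : ∃ a b, 0 ≤ a ∧ b ≤ 1 ∧ s ∈ Ioo a b ∧ t ∈ Ioo a b ∧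
      b - a < ρ := by
    have hd : max s t - min s t < ρ := by rwa [max_sub_min_eq_abs']
    have h0 : 0 < min s t := lt_min hs01.1 ht01.1
    have h1 : max s t < 1 := max_lt hs01.2 ht01.2
    set r := min (min (min s t) (1 - max s t)) ((ρ - (max s t - min s t)) / 4) with hr
    have hr0 : 0 < r := by
      refine lt_min (lt_min h0 (sub_pos.2 h1)) ?_
      linarith
    have hr1 : r ≤ min s t := (min_le_left _ _).trans (min_le_left _ _)
    have hr2 : r ≤ 1 - max s t := (min_le_left _ _).trans (min_le_right _ _)
    have hr3 : r ≤ (ρ - (max s t - min s t)) / 4 := min_le_right _ _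
    refine ⟨min s t - r, max s t + r, by linarith, by linarith, ⟨?_, ?_⟩, ⟨?_, ?_⟩,
      by linarith⟩
    · linarith [min_le_left s t]
    · linarith [le_max_left s t]
    · linarith [min_le_right s t]
    · linarith [le_max_right s t]
  have h1 := htO x' hx' u' v' a b hu' hv' htuv huv' ha hb htab hab
  have h2 := hsO x' hx' a b u v ha hb hsab hab hu hv hsuv huv
  have h3 := (abs_le.1 (hsx x' hx')).2
  have h4 := (abs_le.1 (htx x' hx')).1
  linarith

/-- Almost every point is a density point of a set on which `f` and `Γ` are nearly constant. -/
theorem ae_exists_nearly_constant {Γ : ℝ → Set X} {Φ : ℝ → ℝ → Set X}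
    (hΓ : ∀ t ∈ Icc (0 : ℝ) 1, IsCWK X (Γ t)) (h : vHPrimitive Γ Φ) {f : ℝ → X}
    (hmeas : AEStronglyMeasurable f (volume.restrict (Icc (0 : ℝ) 1))) {ε : ℝ} (hε : 0 < ε) :
    ∀ᵐ t : ℝ, t ∈ Icc (0 : ℝ) 1 → ∃ E : Set ℝ, MeasurableSet E ∧
      (∀ s ∈ E, ‖f s - f t‖ ≤ ε) ∧
      (∀ s ∈ E, ∀ x' : X →L[ℝ] ℝ, ‖x'‖ ≤ 1 → suppFn x' (Γ t) ≤ suppFn x' (Γ s) + ε) ∧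
      ∀ η > 0, ∃ ρ > 0, ∀ u v, FineAt (fun _ => ρ) u t v →
        volume.real (Icc u v \ E) ≤ η * (v - u) := by
  set g := hmeas.mk f with hg
  have hgm : StronglyMeasurable g := hmeas.stronglyMeasurable_mk
  have hbad : volume {t : ℝ | ¬ (IsVarDeriv Γ Φ t ∧ (t ∈ Icc (0 : ℝ) 1 → f t = g t))} = 0 :=
    ae_iff.1 (h.varNull.ae_le.and ((ae_restrict_iff' measurableSet_Icc).1 hmeas.ae_eq_mk))
  obtain ⟨N, hN, hNm, hN0⟩ := exists_measurable_superset_of_null hbad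
  have hgood : ∀ t ∉ N, IsVarDeriv Γ Φ t ∧ (t ∈ Icc (0 : ℝ) 1 → f t = g t) :=
    fun t ht => by_contra fun hc => ht (hN hc)
  obtain ⟨c, hc, hgc⟩ := hgm.isSeparable_range
  have := hc.to_subtype
  set E : ℕ → ℚ → c → Set ℝ := fun n q y =>
    (Nᶜ ∩ Ioo 0 1) ∩ smallOscillation Φ (ε / 6) (1 / ((n : ℝ) + 1)) ∩
      ball (q : ℝ) (1 / ((n : ℝ) + 1) / 2) ∩ g ⁻¹' ball y.1 (ε / 2) with hE
  have hEm : ∀ n q y, MeasurableSet (E n q y) := fun n q y =>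
    (((hNm.compl.inter measurableSet_Ioo).inter
      (isClosed_smallOscillation _ _ _).measurableSet).inter measurableSet_ball).inter
      (measurableSet_lt (hgm.dist stronglyMeasurable_const).measurable measurable_const)
  have hdens : ∀ᵐ t : ℝ, ∀ n q y, t ∈ E n q y → ∀ η > 0, ∃ ρ > 0, ∀ u v,
      FineAt (fun _ => ρ) u t v → volume.real (Icc u v \ E n q y) ≤ η * (v - u) :=
    ae_all_iff.2 fun n => ae_all_iff.2 fun q => ae_all_iff.2 fun y => ae_volume_diff_le (hEm n q y)
  have hNae : ∀ᵐ t : ℝ, t ∉ N := measure_eq_zero_iff_ae_notMem.1 hN0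
  filter_upwards [hdens, hNae, Measure.ae_ne volume (0 : ℝ), Measure.ae_ne volume (1 : ℝ)]
    with t htd htN ht0 ht1 ht01
  have ht01' : t ∈ Ioo (0 : ℝ) 1 := ⟨lt_of_le_of_ne ht01.1 ht0.symm, lt_of_le_of_ne ht01.2 ht1⟩
  obtain ⟨n, hn⟩ := (hgood t htN).1.exists_mem_smallOscillation hΓ h (ε := ε / 6) (by linarith)
  have hn0 : (0 : ℝ) < 1 / ((n : ℝ) + 1) := Nat.one_div_pos_of_nat
  obtain ⟨q, hq1, hq2⟩ := exists_rat_btwn (lt_add_of_pos_right t (half_pos hn0))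
  obtain ⟨y, hyc, hy⟩ := Metric.mem_closure_iff.1 (hgc (mem_range_self t)) (ε / 2) (half_pos hε)
  have htE : t ∈ E n q ⟨y, hyc⟩ := by
    refine ⟨⟨⟨⟨htN, ht01'⟩, hn⟩, ?_⟩, hy⟩
    rw [mem_ball, Real.dist_eq, abs_sub_lt_iff]
    constructor <;> linarith
  refine ⟨E n q ⟨y, hyc⟩, hEm _ _ _, fun s hs => ?_, fun s hs x' hx' => ?_, htd _ _ _ htE⟩
  · rw [(hgood t htN).2 ht01, (hgood s hs.1.1.1.1).2 (Ioo_subset_Icc_self hs.1.1.1.2),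
      ← dist_eq_norm]
    have h1 : dist (g s) y < ε / 2 := hs.2
    have h2 := dist_triangle_right (g s) (g t) y
    linarith
  · have hst : |s - t| < 1 / ((n : ℝ) + 1) := by
      rw [← Real.dist_eq]
      have h1 : dist s q < 1 / ((n : ℝ) + 1) / 2 := hs.1.2
      have h2 : dist t q < 1 / ((n : ℝ) + 1) / 2 := htE.1.2
      have h3 := dist_triangle_right s t (q : ℝ)
      linarith
    have := suppFn_le_of_smallOscillation hΓ h (ε := ε / 6) (by linarith) hs.1.1.1.2 ht01'
      (hgood s hs.1.1.1.1).1 (hgood t htN).1 hs.1.1.2 hn hst hx'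
    linarith

end

/-- Theorem `T4.1` of the paper. If `Γ : [0,1] → cwk(X)` is variationally
Henstock integrable, then every strongly measurable selection of `Γ` is variationally
Henstock integrable. -/
theorem stronglyMeasurable_selection_vH
    {X : Type*} [NormedAddCommGroup X] [NormedSpace ℝ X] [CompleteSpace X]
    (Γ : ℝ → Set X) (hΓ : ∀ t ∈ Icc (0:ℝ) 1, IsCWK X (Γ t))
    (h : vHIntegrable Γ) (f : ℝ → X) (hsel : Selection Γ f)
    (hmeas : AEStronglyMeasurable f (volume.restrict (Icc (0:ℝ) 1))) :
    FvHIntegrable f := by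
  obtain ⟨Φ, hΦ⟩ := h
  obtain ⟨ψ, hψ⟩ := hΦ.exists_weak_primitive hΓ hsel
  have hbound : ∀ t, ∃ M : ℝ, 0 ≤ M ∧ (t ∈ Icc (0 : ℝ) 1 → ∀ x ∈ Γ t, ‖x‖ ≤ M) := by
    intro t
    by_cases ht : t ∈ Icc (0 : ℝ) 1
    · obtain ⟨M, hM⟩ := (hΓ t ht).isBounded.exists_norm_le
      exact ⟨M, (norm_nonneg _).trans (hM _ (hsel t ht)), fun _ => hM⟩
    · exact ⟨0, le_rfl, fun ht' => absurd ht' ht⟩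
  choose M hM0 hM using hbound
  refine fvHIntegrable_of_ae (ψ := ψ) hΦ.varNull (M := fun t => 2 * M t) ?_ ?_
  · intro u t v hu hut htv hv
    have := norm_sub_smul_le_of_nearly_constant hΓ hΦ hsel hψ MeasurableSet.empty ⟨hut, htv⟩
      hu hv (by simp) (by simp) le_rfl (hM t ⟨hu.trans hut, htv.trans hv⟩)
    rw [sdiff_empty, Real.volume_real_Icc_of_le (hut.trans htv)] at this
    linarith
  · have hnc : ∀ᵐ t : ℝ, ∀ k : ℕ, _ := ae_all_iff.2 fun k : ℕ =>
      ae_exists_nearly_constant hΓ hΦ hmeas (Nat.one_div_pos_of_nat (α := ℝ) (n := k))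
    filter_upwards [hnc, hΦ.varNull.ae_le] with t ht htD ht01 η hη
    obtain ⟨k, hk⟩ := exists_nat_one_div_lt (show 0 < η / 6 by linarith)
    obtain ⟨E, hEm, hEf, hEΓ, hEd⟩ := ht k ht01
    have hMt : 0 < 2 * M t + 1 := by linarith [hM0 t]
    obtain ⟨ρ₁, hρ₁, hD⟩ := htD (η / 3) (by linarith)
    obtain ⟨ρ₂, hρ₂, hd⟩ := hEd (η / 3 / (2 * M t + 1)) (div_pos (by linarith) hMt)
    refine ⟨min ρ₁ ρ₂, lt_min hρ₁ hρ₂, fun u v hu hv hf => ?_⟩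
    have huv : 0 ≤ v - u := sub_nonneg.2 (hf.1.trans hf.2.1)
    have h1 := norm_sub_smul_le_of_nearly_constant hΓ hΦ hsel hψ hEm ⟨hf.1, hf.2.1⟩
      hu hv hEf hEΓ Nat.one_div_pos_of_nat.le (hM t ht01)
    have h2 := hD u v hu hv (hf.mono (min_le_left _ _))
    have h3 := hd u v (hf.mono (min_le_right _ _))
    have h4 : 2 * M t * volume.real (Icc u v \ E) ≤ η / 3 * (v - u) := by
      calc 2 * M t * volume.real (Icc u v \ E)
          ≤ (2 * M t + 1) * (η / 3 / (2 * M t + 1) * (v - u)) :=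
            mul_le_mul (by linarith) h3 measureReal_nonneg hMt.le
        _ = η / 3 * (v - u) := by field_simp
    have h5 : 2 * (1 / ((k : ℝ) + 1)) * (v - u) ≤ η / 3 * (v - u) :=
      mul_le_mul_of_nonneg_right (by linarith) huv
    linarith

end GaugePaper
end

section
/- Let X be a Banach space. If Γ : [0,1] → cwk(X) is a variationally Henstock integrable multifunction, then Γ possesses at least one variationally Henstock integrable selection. -/
open Set Metric MeasureTheory Pointwise
open scoped ENNReal NNReal

namespace GaugePaper

variable (X : Type*) [NormedAddCommGroup X] [NormedSpace ℝ X]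

variable {X}

open Filter Topology

section Differentiation

variable {E : Type*} [NormedAddCommGroup E]

/-- Almost every point of a set is a point at which the set has no porosity. -/
lemma ae_forall_eventually_exists_abs_sub_le (A : Set ℝ) :
    ∀ᵐ t : ℝ, t ∈ A → ∀ ε > 0, ∀ᶠ s in 𝓝 t, ∃ s' ∈ A, |s - s'| ≤ ε * |s - t| := by
  filter_upwards [(lipschitz_infDist_pt A).ae_differentiableAt_real] with t ht htA ε hε
  have h0 : infDist t A = 0 := infDist_zero_of_mem htA
  have hmin : IsLocalMin (fun s => infDist s A) t :=
    Eventually.of_forall fun s => by simpa [h0] using infDist_nonneg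
  have hd : HasDerivAt (fun s => infDist s A) 0 t := by
    simpa [hmin.deriv_eq_zero] using ht.hasDerivAt
  have := (hasDerivAt_iff_isLittleO.1 hd).def (half_pos hε)
  filter_upwards [this] with s hs
  rcases eq_or_ne s t with rfl | hst
  · exact ⟨s, htA, by simp⟩
  have hpos : 0 < |s - t| := abs_pos.2 (sub_ne_zero.2 hst)
  have hlt : infDist s A < ε * |s - t| := by
    simp only [h0, sub_zero, smul_zero, Real.norm_eq_abs, abs_of_nonneg infDist_nonneg] at hs
    nlinarith [mul_pos hε hpos]
  obtain ⟨s', hs', hd'⟩ := (infDist_lt_iff ⟨t, htA⟩).1 hlt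
  exact ⟨s', hs', hd'.le⟩

/-- `F` satisfies a Lipschitz estimate with constant `M` between points of `A` and arbitrary points
at distance less than `η`, and any two points of `A` are at distance less than `η`. -/
structure LipFrom (F : ℝ → E) (A : Set ℝ) (M η : ℝ) : Prop where
  nonneg : 0 ≤ M
  pos : 0 < η
  lip : ∀ t ∈ A, ∀ s, |s - t| < η → ‖F s - F t‖ ≤ M * |s - t|
  diam : ∀ t ∈ A, ∀ s ∈ A, |s - t| < η

lemma LipFrom.mono {F : ℝ → E} {A B : Set ℝ} {M η : ℝ} (h : LipFrom F A M η) (hBA : B ⊆ A) :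
    LipFrom F B M η :=
  ⟨h.nonneg, h.pos, fun t ht => h.lip t (hBA ht), fun t ht s hs => h.diam t (hBA ht) s (hBA hs)⟩

lemma LipFrom.lipschitzOnWith {F : ℝ → E} {A : Set ℝ} {M η : ℝ} (h : LipFrom F A M η) :
    LipschitzOnWith M.toNNReal F A := by
  refine LipschitzOnWith.of_dist_le_mul fun s hs t ht => ?_
  rw [dist_eq_norm, Real.dist_eq, Real.coe_toNNReal _ h.nonneg]
  exact h.lip t ht s (h.diam t ht s hs)

lemma LipFrom.sub_smul_const [NormedSpace ℝ E] {F : ℝ → E} {A : Set ℝ} {M η : ℝ}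
    (h : LipFrom F A M η) (y : E) : LipFrom (fun s => F s - s • y) A (M + ‖y‖) η where
  nonneg := add_nonneg h.nonneg (norm_nonneg y)
  pos := h.pos
  diam := h.diam
  lip t ht s hst := by
    have : F s - s • y - (F t - t • y) = (F s - F t) - (s - t) • y := by rw [sub_smul]; abel
    rw [this, add_mul]
    refine (norm_sub_le _ _).trans (add_le_add (h.lip t ht s hst) ?_)
    rw [norm_smul, Real.norm_eq_abs, mul_comm]

lemma LipFrom.clm_comp [NormedSpace ℝ E] {F : ℝ → E} {A : Set ℝ} {M η : ℝ}
    (h : LipFrom F A M η) (φ : E →L[ℝ] ℝ) (hφ : ‖φ‖ ≤ 1) :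
    LipFrom (fun s => φ (F s)) A M η where
  nonneg := h.nonneg
  pos := h.pos
  diam := h.diam
  lip t ht s hst := by
    rw [← map_sub]
    exact ((φ.le_of_opNorm_le hφ _).trans_eq (one_mul _)).trans (h.lip t ht s hst)

/-- A growth estimate along `A` at a point of non-porosity of `A` extends to a full
neighbourhood. -/
lemma LipFrom.eventually_norm_sub_le {H : ℝ → E} {A : Set ℝ} {M η r t : ℝ}
    (h : LipFrom H A M η) (hr : 0 ≤ r)
    (hpor : ∀ ε > 0, ∀ᶠ s in 𝓝 t, ∃ s' ∈ A, |s - s'| ≤ ε * |s - t|)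
    (hA : ∀ ε > 0, ∀ᶠ s in 𝓝[A] t, ‖H s - H t‖ ≤ (r + ε) * |s - t|) :
    ∀ ε > 0, ∀ᶠ s in 𝓝 t, ‖H s - H t‖ ≤ (r + ε) * |s - t| := by
  intro ε hε
  have hM := h.nonneg
  obtain ⟨κ, hκ, hκ1, hκ2⟩ : ∃ κ > 0, κ ≤ 1 ∧ κ * (M + r + 1 + ε) ≤ ε / 2 := by
    refine ⟨min 1 (ε / 2 / (M + r + 1 + ε)), by positivity, min_le_left _ _, ?_⟩
    rw [← le_div_iff₀ (by positivity)]
    exact min_le_right _ _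
  obtain ⟨ρ, hρ, hball⟩ := Metric.eventually_nhds_iff.1
    (eventually_nhdsWithin_iff.1 (hA (ε / 2) (half_pos hε)))
  filter_upwards [hpor κ hκ, Metric.ball_mem_nhds t (half_pos hρ), Metric.ball_mem_nhds t h.pos]
    with s ⟨s', hs', hss'⟩ hs1 hs2
  rw [mem_ball, Real.dist_eq] at hs1 hs2
  have hd0 := abs_nonneg (s - t)
  have h1 : |s - s'| ≤ |s - t| := hss'.trans (by nlinarith)
  have h2 : |s' - t| ≤ (1 + κ) * |s - t| := by
    have := abs_sub_le s' s t
    rw [abs_sub_comm s' s] at this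
    linarith
  have h3 := hball (y := s') (by rw [Real.dist_eq]; nlinarith) hs'
  have h4 := h.lip s' hs' s (h1.trans_lt hs2)
  have h5 : ‖H s - H t‖ ≤ ‖H s - H s'‖ + ‖H s' - H t‖ := norm_sub_le_norm_sub_add_norm_sub _ _ _
  calc ‖H s - H t‖ ≤ M * (κ * |s - t|) + (r + ε / 2) * ((1 + κ) * |s - t|) := by
        refine h5.trans (add_le_add (h4.trans ?_) (h3.trans ?_)) <;> gcongr
    _ = (r + ε / 2 + κ * (M + r + ε / 2)) * |s - t| := by ring
    _ ≤ (r + ε) * |s - t| := by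
        refine mul_le_mul_of_nonneg_right ?_ hd0
        nlinarith

lemma hasDerivAt_of_eventually_norm_sub_le [NormedSpace ℝ E] {F : ℝ → E} {v : E} {t : ℝ}
    (h : ∀ ε > 0, ∀ᶠ s in 𝓝 t, ‖F s - F t - (s - t) • v‖ ≤ ε * |s - t|) : HasDerivAt F v t := by
  rw [hasDerivAt_iff_isLittleO, Asymptotics.isLittleO_iff]
  exact fun ε hε => h ε hε

/-- A scalar version of Stepanov's theorem. -/
lemma LipFrom.ae_differentiableAt {h : ℝ → ℝ} {A : Set ℝ} {M η : ℝ} (hA : LipFrom h A M η) :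
    ∀ᵐ t : ℝ, t ∈ A → DifferentiableAt ℝ h t := by
  filter_upwards [hA.lipschitzOnWith.ae_differentiableWithinAt_of_mem_real,
    ae_forall_eventually_exists_abs_sub_le A] with t hd hpor htA
  obtain ⟨v, hv⟩ : ∃ v, HasDerivWithinAt h v A t := ⟨_, (hd htA).hasDerivWithinAt⟩
  have key := (hA.sub_smul_const v).eventually_norm_sub_le le_rfl (hpor htA) (fun ε hε => by
    filter_upwards [(hasDerivWithinAt_iff_isLittleO.1 hv).def hε] with s hs
    have : h s - s • v - (h t - t • v) = h s - h t - (s - t) • v := by rw [sub_smul]; abel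
    rw [this, zero_add]
    exact hs)
  refine (hasDerivAt_of_eventually_norm_sub_le (v := v) fun ε hε => ?_).differentiableAt
  filter_upwards [key ε hε] with s hs
  have : h s - s • v - (h t - t • v) = h s - h t - (s - t) • v := by rw [sub_smul]; abel
  rwa [this, zero_add] at hs

/-- If the derivatives of countably many equi-Lipschitz functions are bounded by `r` on `A`, then
at almost every point of `A` their increments are bounded by nearly `r`, uniformly. -/
lemma ae_eventually_forall_abs_sub_le {h : ℕ → ℝ → ℝ} {M : ℝ≥0} (hh : ∀ k, LipschitzWith M (h k))
    {A : Set ℝ} {r : ℝ} (hA : ∀ k, ∀ᵐ t : ℝ, t ∈ A → |deriv (h k) t| ≤ r) :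
    ∀ᵐ t : ℝ, t ∈ A → ∀ ε > 0, ∀ᶠ s in 𝓝 t, ∀ k, |h k s - h k t| ≤ (r + ε) * |s - t| := by
  classical
  set B : Set ℝ := {t | ∀ k, |deriv (h k) t| ≤ r} with hB
  have hBm : MeasurableSet B := by
    simp only [hB, ← Real.norm_eq_abs, Set.ofPred_forall]
    exact MeasurableSet.iInter fun k =>
      measurableSet_le (measurable_deriv (h k)).norm measurable_const
  set ψ : ℝ → ℝ := B.piecewise (fun _ => r) (fun _ => (M : ℝ)) with hψ
  have hψm : Measurable ψ := measurable_const.piecewise hBm measurable_const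
  have hψi : LocallyIntegrable ψ := by
    have : LocallyIntegrable (fun _ : ℝ => max |r| (M : ℝ)) := locallyIntegrable_const _
    refine this.mono hψm.aestronglyMeasurable (Eventually.of_forall fun t => ?_)
    have h0 : (0:ℝ) ≤ max |r| (M : ℝ) := le_max_of_le_left (abs_nonneg r)
    rw [Real.norm_eq_abs, Real.norm_eq_abs, abs_of_nonneg h0, hψ, piecewise]
    split_ifs
    · exact le_max_left _ _
    · simp
  have hle : ∀ k t, ‖deriv (h k) t‖ ≤ ψ t := by
    intro k t
    rw [hψ, piecewise]
    split_ifs with ht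
    · exact ht k
    · exact norm_deriv_le_of_lipschitz (hh k)
  have hint : ∀ a b, IntervalIntegrable ψ volume a b := fun a b =>
    intervalIntegrable_iff.mpr <|
      (hψi.integrableOn_isCompact isCompact_uIcc).mono_set uIoc_subset_uIcc
  filter_upwards [_root_.LocallyIntegrable.ae_hasDerivAt_integral hψi, ae_all_iff.2 hA]
    with t ht htA hmem ε hε
  have htB : t ∈ B := fun k => htA k hmem
  have hd := ht t
  rw [show ψ t = r from piecewise_eq_of_mem _ _ _ htB] at hd
  filter_upwards [(hasDerivAt_iff_isLittleO.1 hd).def hε] with s hs k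
  have hftc : h k s - h k t = ∫ x in t..s, deriv (h k) x :=
    ((((hh k).lipschitzOnWith (s := uIcc t s)).absolutelyContinuousOnInterval).integral_deriv_eq_sub
      ).symm
  have h1 : |h k s - h k t| ≤ |∫ x in t..s, ψ x| := by
    rw [hftc]
    exact intervalIntegral.norm_integral_le_abs_of_norm_le
      (Eventually.of_forall fun x => hle k x) (hint t s)
  simp only [intervalIntegral.integral_same, sub_zero, smul_eq_mul, Real.norm_eq_abs] at hs
  have h2 : |∫ x in t..s, ψ x| ≤ |(∫ x in t..s, ψ x) - (s - t) * r| + |(s - t) * r| := by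
    simpa using abs_add_le ((∫ x in t..s, ψ x) - (s - t) * r) ((s - t) * r)
  have hr : 0 ≤ r := (abs_nonneg _).trans (htB 0)
  rw [abs_mul (s - t) r, abs_of_nonneg hr] at h2
  linarith

/-- A property holds almost everywhere on a set of points at which `F` is locally Lipschitz as soon
as it holds almost everywhere on those of its subsets which satisfy `LipFrom`. -/
lemma ae_of_forall_lipFrom {F : ℝ → E} {B : Set ℝ}
    (hB : ∀ t ∈ B, ∃ M : ℝ, ∀ᶠ s in 𝓝 t, ‖F s - F t‖ ≤ M * |s - t|) {p : ℝ → Prop}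
    (hp : ∀ A ⊆ B, ∀ M η, LipFrom F A M η → ∀ᵐ t : ℝ, t ∈ A → p t) :
    ∀ᵐ t : ℝ, t ∈ B → p t := by
  set A : ℕ → ℤ → Set ℝ := fun n k => {t | t ∈ B ∧
    (∀ s, |s - t| < 1 / ((n : ℝ) + 1) → ‖F s - F t‖ ≤ n * |s - t|) ∧
      ⌊t * ((n : ℝ) + 1)⌋ = k} with hA
  have hpos : ∀ n : ℕ, (0:ℝ) < n + 1 := fun n => by positivity
  have hLip : ∀ n k, LipFrom F (A n k) n (1 / ((n : ℝ) + 1)) := fun n k =>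
    { nonneg := n.cast_nonneg
      pos := by positivity
      lip := fun t ht s hst => ht.2.1 s hst
      diam := fun t ht s hs => by
        have := Int.abs_sub_lt_one_of_floor_eq_floor (hs.2.2.trans ht.2.2.symm)
        rw [← sub_mul, abs_mul, abs_of_pos (hpos n)] at this
        rwa [lt_div_iff₀ (hpos n)] }
  have hall := ae_all_iff.2 fun n : ℕ => ae_all_iff.2 fun k : ℤ =>
    hp (A n k) (fun t ht => ht.1) n _ (hLip n k)
  filter_upwards [hall] with t ht htB
  obtain ⟨M, hM⟩ := hB t htB
  obtain ⟨ρ, hρ, hball⟩ := Metric.eventually_nhds_iff.1 hM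
  obtain ⟨n₁, hn₁⟩ := exists_nat_ge M
  obtain ⟨n₂, hn₂⟩ := exists_nat_one_div_lt hρ
  refine ht (max n₁ n₂) _ ⟨htB, fun s hs => ?_, rfl⟩
  have h1 : (n₁ : ℝ) ≤ (max n₁ n₂ : ℕ) := by exact_mod_cast le_max_left _ _
  have h2 : (n₂ : ℝ) ≤ (max n₁ n₂ : ℕ) := by exact_mod_cast le_max_right _ _
  have h3 : 1 / (((max n₁ n₂ : ℕ) : ℝ) + 1) ≤ 1 / ((n₂ : ℝ) + 1) := by
    gcongr
  refine (hball (y := s) ?_).trans (by gcongr; exact hn₁.trans h1)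
  rw [Real.dist_eq]
  linarith

variable [NormedSpace ℝ E]

/-- If the scalar derivatives of `F` along a norming sequence of functionals are those of `f`, and
`f` stays within `r` of `y` on `A`, then so do the difference quotients of `F` near almost every
point of `A`. -/
lemma LipFrom.ae_eventually_norm_sub_sub_smul_le {F f : ℝ → E} {A : Set ℝ} {M η r : ℝ}
    (hA : LipFrom F A M η) {φ : ℕ → E →L[ℝ] ℝ} (hφ : ∀ k, ‖φ k‖ ≤ 1) {Y : Submodule ℝ E}
    (hY : ∀ v ∈ Y, ∀ c, (∀ k, |φ k v| ≤ c) → ‖v‖ ≤ c) (hF : ∀ s, F s ∈ Y) {y : E} (hy : y ∈ Y)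
    (hder : ∀ t ∈ A, ∀ k, HasDerivAt (fun s => φ k (F s)) (φ k (f t)) t)
    (hr : 0 ≤ r) (hf : ∀ t ∈ A, ‖f t - y‖ ≤ r) :
    ∀ᵐ t : ℝ, t ∈ A → ∀ ε > 0, ∀ᶠ s in 𝓝 t,
      ‖F s - F t - (s - t) • y‖ ≤ (r + ε) * |s - t| := by
  set H : ℝ → E := fun s => F s - s • y with hH
  have hHsub : ∀ s t, H s - H t = F s - F t - (s - t) • y := fun s t => by
    simp only [hH, sub_smul]; abel
  have hHA : LipFrom H A (M + ‖y‖) η := hA.sub_smul_const y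
  have hHder : ∀ t ∈ A, ∀ k, HasDerivAt (fun s => φ k (H s)) (φ k (f t - y)) t := by
    intro t ht k
    have := (hder t ht k).sub ((hasDerivAt_id t).mul_const (φ k y))
    simpa [hH, map_sub, Pi.sub_def] using this
  choose h hlip heq using fun k => ((hHA.clm_comp (φ k) (hφ k)).lipschitzOnWith).extend_real
  have hderiv : ∀ k, ∀ᵐ t : ℝ, t ∈ A → |deriv (h k) t| ≤ r := by
    intro k
    filter_upwards [(hlip k).ae_differentiableAt_real, ae_forall_eventually_exists_abs_sub_le A]
      with t hd hpor htA
    have hacc : UniqueDiffWithinAt ℝ A t := by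
      rw [uniqueDiffWithinAt_iff_accPt, accPt_iff_frequently]
      rw [Metric.nhds_basis_ball.frequently_iff]
      intro ρ hρ
      obtain ⟨ρ', hρ', hb⟩ := Metric.eventually_nhds_iff.1 (hpor htA (1 / 2) (by norm_num))
      set d := min (ρ / 2) (ρ' / 2) with hd
      have hd0 : 0 < d := by positivity
      have hd1 : d ≤ ρ / 2 := min_le_left _ _
      have hd2 : d ≤ ρ' / 2 := min_le_right _ _
      obtain ⟨s', hs', hss'⟩ := hb (y := t + d)
        (by rw [Real.dist_eq, add_sub_cancel_left, abs_of_pos hd0]; linarith)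
      rw [add_sub_cancel_left, abs_of_pos hd0, abs_le] at hss'
      refine ⟨s', ?_, ?_, hs'⟩
      · rw [mem_ball, Real.dist_eq, abs_lt]
        constructor <;> linarith [hss'.1, hss'.2]
      · rintro rfl
        linarith [hss'.1, hss'.2]
    have e1 : HasDerivWithinAt (fun s => φ k (H s)) (deriv (h k) t) A t :=
      (hd.hasDerivAt.hasDerivWithinAt).congr (fun x hx => heq k hx) (heq k htA)
    have e2 := hacc.eq_deriv _ e1 (hHder t htA k).hasDerivWithinAt
    rw [e2]
    exact ((φ k).le_of_opNorm_le (hφ k) _).trans ((one_mul _).trans_le (hf t htA))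
  filter_upwards [ae_eventually_forall_abs_sub_le hlip hderiv,
    ae_forall_eventually_exists_abs_sub_le A] with t h1 hpor htA
  have key := hHA.eventually_norm_sub_le hr (hpor htA) (fun ε hε => by
    refine eventually_nhdsWithin_iff.2 ?_
    filter_upwards [h1 htA ε hε] with s hs hsA
    refine hY _ ?_ _ fun k => ?_
    · rw [hHsub]
      exact Y.sub_mem (Y.sub_mem (hF s) (hF t)) (Y.smul_mem _ hy)
    · have := hs k
      rwa [← heq k hsA, ← heq k htA, ← map_sub] at this)
  simpa only [hHsub] using key

/-- The scalar functions `φ k ∘ F` are differentiable at almost every point at which `F` is locally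
Lipschitz. -/
lemma ae_forall_differentiableAt {F : ℝ → E} {B : Set ℝ}
    (hB : ∀ t ∈ B, ∃ M : ℝ, ∀ᶠ s in 𝓝 t, ‖F s - F t‖ ≤ M * |s - t|)
    {φ : ℕ → E →L[ℝ] ℝ} (hφ : ∀ k, ‖φ k‖ ≤ 1) :
    ∀ᵐ t : ℝ, t ∈ B → ∀ k, DifferentiableAt ℝ (fun s => φ k (F s)) t := by
  refine ae_of_forall_lipFrom hB fun A _ M η hA => ?_
  filter_upwards [ae_all_iff.2 fun k => (hA.clm_comp (φ k) (hφ k)).ae_differentiableAt]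
    with t ht htA k using ht k htA

/-- If the scalar derivatives of a locally Lipschitz function `F` along a norming sequence of
functionals are those of a separably valued function `f`, then `f` is almost everywhere the norm
derivative of `F`. -/
lemma ae_hasDerivAt {F f : ℝ → E} {B : Set ℝ}
    (hB : ∀ t ∈ B, ∃ M : ℝ, ∀ᶠ s in 𝓝 t, ‖F s - F t‖ ≤ M * |s - t|)
    {φ : ℕ → E →L[ℝ] ℝ} (hφ : ∀ k, ‖φ k‖ ≤ 1) {Y : Submodule ℝ E}
    (hY : ∀ v ∈ Y, ∀ c, (∀ k, |φ k v| ≤ c) → ‖v‖ ≤ c) (hF : ∀ s, F s ∈ Y)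
    {y : ℕ → E} (hyY : ∀ j, y j ∈ Y) (hy : (Y : Set E) ⊆ closure (range y))
    (hf : ∀ t ∈ B, f t ∈ Y)
    (hder : ∀ t ∈ B, ∀ k, HasDerivAt (fun s => φ k (F s)) (φ k (f t)) t) :
    ∀ᵐ t : ℝ, t ∈ B → HasDerivAt F (f t) t := by
  refine ae_of_forall_lipFrom hB fun A hAB M η hA => ?_
  have hr : ∀ q : ℕ, (0:ℝ) < 1 / ((q : ℝ) + 1) := fun q => by positivity
  have hall := ae_all_iff.2 fun q : ℕ => ae_all_iff.2 fun j : ℕ =>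
    (hA.mono (B := {t | t ∈ A ∧ ‖f t - y j‖ ≤ 1 / ((q : ℝ) + 1)})
      fun t ht => ht.1).ae_eventually_norm_sub_sub_smul_le (f := f) hφ hY hF (hyY j)
      (fun t ht => hder t (hAB ht.1)) (hr q).le (fun t ht => ht.2)
  filter_upwards [hall] with t ht htA
  refine hasDerivAt_of_eventually_norm_sub_le fun ε hε => ?_
  obtain ⟨q, hq⟩ := exists_nat_one_div_lt (show 0 < ε / 3 by positivity)
  obtain ⟨_, ⟨j, rfl⟩, hj⟩ := Metric.mem_closure_iff.1 (hy (hf t (hAB htA))) _ (hr q)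
  rw [dist_eq_norm] at hj
  filter_upwards [ht q j ⟨htA, hj.le⟩ (ε / 3) (by positivity)] with s hs
  have h1 : F s - F t - (s - t) • f t
      = (F s - F t - (s - t) • y j) - (s - t) • (f t - y j) := by
    rw [smul_sub]; abel
  rw [h1]
  refine (norm_sub_le _ _).trans ?_
  rw [norm_smul, Real.norm_eq_abs]
  have h0 := abs_nonneg (s - t)
  nlinarith [mul_le_mul_of_nonneg_left hj.le h0, mul_le_mul_of_nonneg_left hq.le h0]

end Differentiation

section Gauge

/-- `PartialSum δ g x v`: some `δ`-fine Perron partition of `[0,x]` has `g`-sum equal to `v`. -/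
inductive PartialSum (δ : ℝ → ℝ) (g : ℝ → ℝ → ℝ → ℝ) : ℝ → ℝ → Prop
  | zero : PartialSum δ g 0 0
  | snoc {a b t v : ℝ} : PartialSum δ g a v → t ∈ Icc a b → t ∈ Icc (0:ℝ) 1 →
      Icc a b ⊆ Ioo (t - δ t) (t + δ t) → PartialSum δ g b (v + g a b t)

variable {δ : ℝ → ℝ} {g : ℝ → ℝ → ℝ → ℝ}

lemma PartialSum.exists_partition {x v : ℝ} (h : PartialSum δ g x v) :
    ∃ (n : ℕ) (pt : Fin (n + 1) → ℝ) (tag : Fin n → ℝ), Monotone pt ∧ pt 0 = 0 ∧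
      pt (Fin.last n) = x ∧
      (∀ i, tag i ∈ Icc (0:ℝ) 1 ∧ tag i ∈ Icc (pt i.castSucc) (pt i.succ) ∧
        Icc (pt i.castSucc) (pt i.succ) ⊆ Ioo (tag i - δ (tag i)) (tag i + δ (tag i))) ∧
      ∑ i, g (pt i.castSucc) (pt i.succ) (tag i) = v := by
  induction h with
  | zero =>
    exact ⟨0, fun _ => 0, fun _ => 0, monotone_const, rfl, rfl, fun i => i.elim0, by simp⟩
  | @snoc a b t v _ ht ht' hfine ih =>
    obtain ⟨n, pt, tag, hmono, h0, hlast, htag, hsum⟩ := ih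
    have hs : ∀ i : Fin n, (Fin.snoc pt b : Fin (n + 2) → ℝ) i.castSucc.succ = pt i.succ :=
      fun i => by rw [Fin.succ_castSucc, Fin.snoc_castSucc]
    have hl : (Fin.snoc pt b : Fin (n + 2) → ℝ) (Fin.last n).succ = b := by
      rw [Fin.succ_last, Fin.snoc_last]
    refine ⟨n + 1, Fin.snoc (α := fun _ => ℝ) pt b, Fin.snoc (α := fun _ => ℝ) tag t,
      ?_, ?_, ?_, ?_, ?_⟩
    · rw [Fin.monotone_iff_le_succ]
      intro i
      induction i using Fin.lastCases with
      | last => rw [hl, Fin.snoc_castSucc, hlast]; exact ht.1.trans ht.2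
      | cast i => rw [hs, Fin.snoc_castSucc]; exact hmono i.castSucc_le_succ
    · rw [← Fin.castSucc_zero, Fin.snoc_castSucc, h0]
    · rw [Fin.snoc_last]
    · intro i
      induction i using Fin.lastCases with
      | last => rw [hl, Fin.snoc_castSucc, Fin.snoc_last, hlast]; exact ⟨ht', ht, hfine⟩
      | cast i => rw [hs, Fin.snoc_castSucc, Fin.snoc_castSucc]; exact htag i
    · rw [Fin.sum_univ_castSucc, hl, Fin.snoc_castSucc, Fin.snoc_last, hlast, ← hsum]
      simp only [hs, Fin.snoc_castSucc]

/-- Cousin's lemma. -/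
lemma PartialSum.exists_extend (hδ : IsGauge δ) (hg : ∀ a b t, 0 ≤ g a b t) {a b v : ℝ}
    (h : PartialSum δ g a v) (ha : 0 ≤ a) (hab : a ≤ b) (hb : b ≤ 1) :
    ∃ v', v ≤ v' ∧ PartialSum δ g b v' := by
  set S : Set ℝ := {x | x ∈ Icc a b ∧ ∃ v', v ≤ v' ∧ PartialSum δ g x v'} with hS
  have haS : a ∈ S := ⟨⟨le_rfl, hab⟩, v, le_rfl, h⟩
  have hbdd : BddAbove S := ⟨b, fun x hx => hx.1.2⟩
  set c := sSup S with hc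
  have hac : a ≤ c := le_csSup hbdd haS
  have hcb : c ≤ b := csSup_le ⟨a, haS⟩ fun x hx => hx.1.2
  have hc01 : c ∈ Icc (0:ℝ) 1 := ⟨ha.trans hac, hcb.trans hb⟩
  have hδc := hδ c hc01
  obtain ⟨x, ⟨hx, v₁, hv₁, hx'⟩, hcx⟩ := exists_lt_of_lt_csSup ⟨a, haS⟩ (sub_lt_self c hδc)
  have hxc : x ≤ c := le_csSup hbdd ⟨hx, v₁, hv₁, hx'⟩
  set d := min b (c + δ c / 2) with hd
  have hcd : c ≤ d := le_min hcb (by linarith)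
  have hdS : d ∈ S := by
    refine ⟨⟨hac.trans hcd, min_le_left _ _⟩, v₁ + g x d c, ?_, hx'.snoc ⟨hxc, hcd⟩ hc01 ?_⟩
    · linarith [hg x d c]
    · intro z hz
      have := min_le_right b (c + δ c / 2)
      exact ⟨hcx.trans_le hz.1, by linarith [hz.2]⟩
  have hdc : d ≤ c := le_csSup hbdd hdS
  have hdb : d = b := by
    rcases min_choice b (c + δ c / 2) with h | h
    · rw [hd, h]
    · rw [hd, h] at hdc; linarith
  exact (hdb ▸ hdS).2

/-- A uniform bound on the `g`-sums of fine partitions yields a monotone majorant of `g`. -/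
lemma exists_monotoneOn_majorant (hδ : IsGauge δ) (hg : ∀ a b t, 0 ≤ g a b t) {ε : ℝ}
    (h : ∀ (n : ℕ) (P : TP n), P.IsPerron → P.IsFine δ →
      ∑ i : Fin n, g (P.pt i.castSucc) (P.pt i.succ) (P.tag i) < ε) :
    ∃ V : ℝ → ℝ, MonotoneOn V (Icc 0 1) ∧ (∀ x ∈ Icc (0:ℝ) 1, 0 ≤ V x ∧ V x ≤ ε) ∧
      ∀ a b t, 0 ≤ a → a ≤ t → t ≤ b → b ≤ 1 → Icc a b ⊆ Ioo (t - δ t) (t + δ t) →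
        g a b t ≤ V b - V a := by
  have hbd : ∀ x ∈ Icc (0:ℝ) 1, ∀ v, PartialSum δ g x v → v ≤ ε := by
    intro x hx v hv
    obtain ⟨v', hvv', hv'⟩ := hv.exists_extend hδ hg hx.1 hx.2 le_rfl
    obtain ⟨n, pt, tag, hmono, h0, hlast, htag, hsum⟩ := hv'.exists_partition
    have := h n ⟨pt, tag, hmono, h0, hlast, fun i => (htag i).1⟩ (fun i => (htag i).2.1)
      (fun i => (htag i).2.2)
    exact hvv'.trans (hsum ▸ this).le
  have hbdd : ∀ x ∈ Icc (0:ℝ) 1, BddAbove {v | PartialSum δ g x v} :=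
    fun x hx => ⟨ε, fun v hv => hbd x hx v hv⟩
  have hne : ∀ x ∈ Icc (0:ℝ) 1, ∃ v, 0 ≤ v ∧ PartialSum δ g x v := fun x hx =>
    PartialSum.zero.exists_extend hδ hg le_rfl hx.1 hx.2
  refine ⟨fun x => sSup {v | PartialSum δ g x v}, ?_, ?_, ?_⟩
  · intro a ha b hb hab
    obtain ⟨v, _, hv⟩ := hne a ha
    refine csSup_le ⟨v, hv⟩ fun w hw => ?_
    obtain ⟨w', hww', hw'⟩ := PartialSum.exists_extend hδ hg hw ha.1 hab hb.2
    exact hww'.trans (le_csSup (hbdd b hb) hw')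
  · intro x hx
    obtain ⟨v, hv0, hv⟩ := hne x hx
    exact ⟨hv0.trans (le_csSup (hbdd x hx) hv), csSup_le ⟨v, hv⟩ (hbd x hx)⟩
  · intro a b t ha hat htb hb hfine
    have ha' : a ∈ Icc (0:ℝ) 1 := ⟨ha, (hat.trans htb).trans hb⟩
    obtain ⟨v, _, hv⟩ := hne a ha'
    have : sSup {v | PartialSum δ g a v} ≤ sSup {v | PartialSum δ g b v} - g a b t := by
      refine csSup_le ⟨v, hv⟩ fun w hw => ?_
      rw [le_sub_iff_add_le]
      exact le_csSup (hbdd b ⟨ha.trans (hat.trans htb), hb⟩)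
        (PartialSum.snoc hw ⟨hat, htb⟩ ⟨ha.trans hat, htb.trans hb⟩ hfine)
    simp only
    linarith

/-- If the `g`-sums of fine partitions are arbitrarily small, then `g a b t = o(b - a)` at almost
every `t`. -/
lemma ae_forall_exists_le_mul_sub (hg : ∀ a b t, 0 ≤ g a b t)
    (h : ∀ ε > 0, ∃ δ : ℝ → ℝ, IsGauge δ ∧ ∀ (n : ℕ) (P : TP n), P.IsPerron → P.IsFine δ →
      ∑ i : Fin n, g (P.pt i.castSucc) (P.pt i.succ) (P.tag i) < ε) :
    ∀ᵐ t : ℝ, t ∈ Ioo (0:ℝ) 1 → ∀ ε > 0, ∃ η > 0, ∀ a b, 0 ≤ a → a ≤ t → t ≤ b → b ≤ 1 →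
      b - a < η → g a b t ≤ ε * (b - a) := by
  choose δ hδ hsum using fun k : ℕ => h ((1 / 4) ^ k) (by positivity)
  choose V hmono hbd hV using fun k => exists_monotoneOn_majorant (hδ k) hg (hsum k)
  have hsm : ∀ x ∈ Icc (0:ℝ) 1, Summable fun k => 2 ^ k * V k x := by
    intro x hx
    refine Summable.of_nonneg_of_le (fun k => mul_nonneg (by positivity) (hbd k x hx).1)
      (fun k => ?_) (summable_geometric_of_lt_one (r := (1 / 2 : ℝ)) (by norm_num) (by norm_num))
    calc 2 ^ k * V k x ≤ 2 ^ k * (1 / 4) ^ k := by gcongr; exact (hbd k x hx).2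
      _ = (1 / 2) ^ k := by rw [← mul_pow]; norm_num
  set W : ℝ → ℝ := fun x => ∑' k, 2 ^ k * V k x with hW
  have hdiff : ∀ a ∈ Icc (0:ℝ) 1, ∀ b ∈ Icc (0:ℝ) 1, a ≤ b → ∀ k,
      2 ^ k * (V k b - V k a) ≤ W b - W a := by
    intro a ha b hb hab k
    rw [hW]
    simp only
    rw [← (hsm b hb).tsum_sub (hsm a ha)]
    simp only [← mul_sub]
    have hs : Summable fun k => 2 ^ k * (V k b - V k a) := by
      simpa only [mul_sub] using (hsm b hb).sub (hsm a ha)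
    exact hs.le_tsum k fun j _ => mul_nonneg (by positivity) (sub_nonneg.2 (hmono j ha hb hab))
  have hWm : MonotoneOn W (Icc 0 1) := by
    intro a ha b hb hab
    have h1 := hdiff a ha b hb hab 0
    have h2 := hmono 0 ha hb hab
    rw [pow_zero, one_mul] at h1
    linarith
  filter_upwards [hWm.ae_differentiableWithinAt_of_mem] with t ht ht01 ε hε
  have htI := Ioo_subset_Icc_self ht01
  have hd : DifferentiableAt ℝ W t := (ht htI).differentiableAt (Icc_mem_nhds ht01.1 ht01.2)
  obtain ⟨C, hC0, hC⟩ := hd.isBigO_sub.exists_pos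
  obtain ⟨ρ, hρ, hball⟩ := Metric.eventually_nhds_iff.1 hC.bound
  obtain ⟨k, hk⟩ := exists_pow_lt_of_lt_one (div_pos hε hC0) (show (1 / 2 : ℝ) < 1 by norm_num)
  refine ⟨min ρ (δ k t), lt_min hρ (hδ k t htI), fun a b ha hat htb hb hab => ?_⟩
  have hρ' := hab.trans_le (min_le_left _ _)
  have hδ' := hab.trans_le (min_le_right _ _)
  have haI : a ∈ Icc (0:ℝ) 1 := ⟨ha, (hat.trans htb).trans hb⟩
  have hbI : b ∈ Icc (0:ℝ) 1 := ⟨ha.trans (hat.trans htb), hb⟩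
  have h1 := hV k a b t ha hat htb hb fun z hz => ⟨by linarith [hz.1], by linarith [hz.2]⟩
  have h2 := hdiff a haI b hbI (hat.trans htb) k
  have h3 := hball (y := a) (by rw [Real.dist_eq, abs_of_nonpos (by linarith)]; linarith)
  have h4 := hball (y := b) (by rw [Real.dist_eq, abs_of_nonneg (by linarith)]; linarith)
  rw [Real.norm_eq_abs, Real.norm_eq_abs, abs_of_nonpos (sub_nonpos.2 hat)] at h3
  rw [Real.norm_eq_abs, Real.norm_eq_abs, abs_of_nonneg (sub_nonneg.2 htb)] at h4
  have h5 : 2 ^ k * g a b t ≤ C * (b - a) := by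
    have := mul_le_mul_of_nonneg_left h1 (show (0:ℝ) ≤ 2 ^ k by positivity)
    linarith [neg_abs_le (W a - W t), le_abs_self (W b - W t)]
  rw [lt_div_iff₀ hC0] at hk
  have h6 : (1 / 2 : ℝ) ^ k * 2 ^ k = 1 := by rw [← mul_pow]; norm_num
  calc g a b t = (1 / 2) ^ k * (2 ^ k * g a b t) := by rw [← mul_assoc, h6, one_mul]
    _ ≤ (1 / 2) ^ k * (C * (b - a)) := by gcongr
    _ = ((1 / 2) ^ k * C) * (b - a) := by ring
    _ ≤ ε * (b - a) := by gcongr; linarith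

lemma sum_succ_sub_castSucc {n : ℕ} (p : Fin (n + 1) → ℝ) :
    ∑ i : Fin n, (p i.succ - p i.castSucc) = p (Fin.last n) - p 0 := by
  induction n with
  | zero => simp
  | succ n ih =>
    rw [Fin.sum_univ_castSucc]
    have := ih fun i => p i.castSucc
    simp only [Fin.succ_castSucc, Fin.succ_last, Fin.castSucc_zero] at this ⊢
    rw [this]
    ring

/-- The contribution to Riemann sums of the tags from a null set can be made arbitrarily small. -/
lemma exists_monotone_of_null {N : Set ℝ} (hN : volume N = 0) (c : ℝ → ℝ) {ε : ℝ} (hε : 0 < ε) :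
    ∃ w : ℝ → ℝ, Monotone w ∧ w 1 - w 0 ≤ ε ∧ ∃ δ : ℝ → ℝ, (∀ t, 0 < δ t) ∧ ∀ t ∈ N, ∀ a b,
      a ≤ b → Icc a b ⊆ Ioo (t - δ t) (t + δ t) → (b - a) * c t ≤ w b - w a := by
  set f : ℝ → ℝ≥0∞ := (toMeasurable volume N).indicator fun _ => ⊤ with hf
  obtain ⟨G, hfG, hG, hGint⟩ := exists_le_lowerSemicontinuous_lintegral_ge volume f
    (measurable_const.indicator (measurableSet_toMeasurable _ _))
    (ε := ENNReal.ofReal ε) (by simpa using hε)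
  have hf0 : ∫⁻ x, f x = 0 := by
    rw [hf, lintegral_indicator (measurableSet_toMeasurable _ _)]
    simp [hN]
  rw [hf0, zero_add] at hGint
  have hfin : ∀ s : Set ℝ, ∫⁻ x in s, G x ≠ ⊤ := fun s =>
    ((setLIntegral_le_lintegral s G).trans hGint |>.trans_lt ENNReal.ofReal_lt_top).ne
  set w : ℝ → ℝ := fun x => (∫⁻ y in Iic x, G y).toReal with hw
  have hwsub : ∀ a b, a ≤ b → w b - w a = (∫⁻ y in Ioc a b, G y).toReal := by
    intro a b hab
    have : ∫⁻ y in Iic b, G y = (∫⁻ y in Iic a, G y) + ∫⁻ y in Ioc a b, G y := by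
      rw [← Iic_union_Ioc_eq_Iic hab, lintegral_union measurableSet_Ioc (Iic_disjoint_Ioc le_rfl)]
    simp only [hw]
    rw [this, ENNReal.toReal_add (hfin _) (hfin _), add_sub_cancel_left]
  have hδ : ∀ t, ∃ δ > 0, t ∈ N → ∀ s ∈ Ioo (t - δ) (t + δ), ENNReal.ofReal (c t) ≤ G s := by
    intro t
    by_cases ht : t ∈ N
    · have htop : ENNReal.ofReal (c t) < G t := by
        refine lt_of_lt_of_le ?_ (hfG t)
        rw [hf, indicator_of_mem (subset_toMeasurable _ _ ht)]
        exact ENNReal.ofReal_lt_top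
      obtain ⟨δ, hδ, hb⟩ := Metric.eventually_nhds_iff.1 (hG t _ htop)
      refine ⟨δ, hδ, fun _ s hs => (hb (y := s) ?_).le⟩
      rw [Real.dist_eq, abs_lt]
      constructor <;> linarith [hs.1, hs.2]
    · exact ⟨1, one_pos, fun h => absurd h ht⟩
  choose δ hδpos hδG using hδ
  refine ⟨w, fun a b hab => ?_, ?_, δ, hδpos, fun t ht a b hab hfine => ?_⟩
  · rw [← sub_nonneg, hwsub a b hab]
    exact ENNReal.toReal_nonneg
  · rw [hwsub 0 1 zero_le_one]
    exact ENNReal.toReal_le_of_le_ofReal hε.le ((setLIntegral_le_lintegral _ G).trans hGint)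
  · rw [hwsub a b hab]
    have h1 : ENNReal.ofReal (c t) * ENNReal.ofReal (b - a) ≤ ∫⁻ y in Ioc a b, G y := by
      rw [← Real.volume_Ioc, ← setLIntegral_const]
      exact setLIntegral_mono' measurableSet_Ioc fun s hs =>
        hδG t ht s (hfine (Ioc_subset_Icc_self hs))
    have h2 := ENNReal.toReal_mono (hfin _) h1
    rw [ENNReal.toReal_mul, ENNReal.toReal_ofReal (sub_nonneg.2 hab)] at h2
    have h3 : c t ≤ (ENNReal.ofReal (c t)).toReal := by
      rw [ENNReal.toReal_ofReal']; exact le_max_left _ _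
    nlinarith [sub_nonneg.2 hab]

end Gauge

section WeaklyCompact

lemma IsCWK.exists_norm_le {A : Set X} (hA : IsCWK X A) : ∃ C, ∀ x ∈ A, ‖x‖ ≤ C := by
  obtain ⟨C, hC⟩ := banach_steinhaus
    (g := fun x : A => NormedSpace.inclusionInDoubleDual ℝ X x) (fun φ => by
      obtain ⟨C, hC⟩ := (hA.2.2.image (WeakBilin.eval_continuous
        (topDualPairing ℝ X).flip φ)).isBounded.exists_norm_le
      exact ⟨C, fun x => hC _ ⟨_, ⟨x, x.2, rfl⟩, rfl⟩⟩)
  refine ⟨C, fun x hx => ?_⟩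
  rw [← (NormedSpace.inclusionInDoubleDualLi (E := X) ℝ).norm_map x]
  exact hC ⟨x, hx⟩

lemma IsCWK.exists_extreme {A : Set X} (hA : IsCWK X A) :
    ∃ e ∈ A, ∀ x ∈ A, ∀ y ∈ A, x + y = e + e → x = e := by
  have : LocallyConvexSpace ℝ (WeakSpace ℝ X) :=
    inferInstanceAs (LocallyConvexSpace ℝ (WeakBilin (topDualPairing ℝ X).flip))
  obtain ⟨_, ⟨e, he, rfl⟩, hext⟩ := hA.2.2.extremePoints_nonempty (hA.1.image _)
  refine ⟨e, he, fun x hx y hy hxy => ?_⟩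
  have hseg : toWeakSpace ℝ X e ∈ openSegment ℝ (toWeakSpace ℝ X x) (toWeakSpace ℝ X y) := by
    refine ⟨1 / 2, 1 / 2, by norm_num, by norm_num, by norm_num, ?_⟩
    rw [← smul_add, ← map_add, hxy, ← two_smul ℝ e, ← map_smul, smul_smul]
    norm_num
  exact (toWeakSpace ℝ X).injective (hext ⟨x, hx, rfl⟩ ⟨y, hy, rfl⟩ hseg)

/-- An additive interval multifunction with weakly compact convex values has an additive
selection. -/
lemma AdditiveIntervalMF.exists_selection {Φ : ℝ → ℝ → Set X} (hadd : AdditiveIntervalMF Φ)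
    (hΦ : IsCWK X (Φ 0 1)) :
    ∃ F : ℝ → X, (∀ a b, 0 ≤ a → a ≤ b → b ≤ 1 → F b - F a ∈ Φ a b) ∧
      ∀ x ∉ Icc (0:ℝ) 1, F x = 0 := by
  obtain ⟨e, he, hext⟩ := hΦ.exists_extreme
  have hsplit : ∀ x, ∃ u, (x ∈ Icc (0:ℝ) 1 → u ∈ Φ 0 x ∧ e - u ∈ Φ x 1) ∧
      (x ∉ Icc (0:ℝ) 1 → u = 0) := by
    intro x
    by_cases hx : x ∈ Icc (0:ℝ) 1
    · rw [hadd 0 x 1 le_rfl hx.1 hx.2 le_rfl] at he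
      obtain ⟨u, hu, v, hv, rfl⟩ := he
      exact ⟨u, fun _ => ⟨hu, by simpa using hv⟩, fun h => absurd hx h⟩
    · exact ⟨0, fun h => absurd h hx, fun _ => rfl⟩
  choose F hF hF0 using hsplit
  refine ⟨F, fun a b ha hab hb => ?_, hF0⟩
  have haI : a ∈ Icc (0:ℝ) 1 := ⟨ha, hab.trans hb⟩
  have hFb := hF b ⟨ha.trans hab, hb⟩
  have hFa := hF a haI
  have h1 := hFb.1
  rw [hadd 0 a b le_rfl ha hab hb] at h1
  obtain ⟨p, hp, q, hq, hpq⟩ := h1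
  have h2 : q + (e - F b) ∈ Φ a 1 := by
    rw [hadd a b 1 ha hab hb le_rfl]
    exact add_mem_add hq hFb.2
  have h3 : p = F a := by
    have hmem := hadd 0 a 1 le_rfl ha haI.2 le_rfl
    have := hext (p + (e - F a)) (hmem ▸ add_mem_add hp hFa.2)
      (F a + (q + (e - F b))) (hmem ▸ add_mem_add hFa.1 h2) (by rw [← hpq]; simp only; abel)
    rwa [← add_sub_assoc, add_comm, add_sub_assoc, add_eq_left, sub_eq_zero] at this
  rw [← hpq, ← h3]
  simpa using hq

/-- If the increments of `F` at `t` are asymptotically in a weakly compact set, then this set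
contains a point which agrees with all existing scalar derivatives of `F` at `t`. -/
lemma IsCWK.exists_scalar_deriv {A : Set X} (hA : IsCWK X A) {F : ℝ → X} {t : ℝ}
    (hF : ∀ ε > 0, ∀ᶠ s in 𝓝 t, ∃ z ∈ A, ‖F s - F t - (s - t) • z‖ ≤ ε * |s - t|) :
    ∃ w ∈ A, ∀ (φ : X →L[ℝ] ℝ) (L : ℝ), HasDerivAt (fun s => φ (F s)) L t → φ w = L := by
  have hinf : Tendsto (fun s => infDist (slope F t s) A) (𝓝[≠] t) (𝓝 0) := by
    rw [Metric.tendsto_nhds]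
    intro ε hε
    filter_upwards [(hF (ε / 2) (half_pos hε)).filter_mono nhdsWithin_le_nhds,
      self_mem_nhdsWithin] with s ⟨z, hz, hs⟩ hst
    have hst' : s - t ≠ 0 := sub_ne_zero.2 hst
    rw [Real.dist_eq, sub_zero, abs_of_nonneg infDist_nonneg]
    refine (infDist_le_dist_of_mem hz).trans_lt ?_
    have : slope F t s - z = (s - t)⁻¹ • (F s - F t - (s - t) • z) := by
      rw [slope, smul_sub, inv_smul_smul₀ hst']; rfl
    rw [dist_eq_norm, this, norm_smul, norm_inv, Real.norm_eq_abs]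
    have hpos := abs_pos.2 hst'
    rw [inv_mul_lt_iff₀ hpos]
    nlinarith
  have hg : ∀ s, ∃ z ∈ A, s ≠ t → dist (slope F t s) z ≤ infDist (slope F t s) A + |s - t| := by
    intro s
    by_cases hst : s = t
    · obtain ⟨z, hz⟩ := hA.1
      exact ⟨z, hz, fun h => absurd hst h⟩
    · obtain ⟨z, hz, h⟩ := (infDist_lt_iff hA.1).1
        (lt_add_of_pos_right (infDist (slope F t s) A) (abs_pos.2 (sub_ne_zero.2 hst)))
      exact ⟨z, hz, fun _ => h.le⟩
  choose g hgA hg using hg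
  have hlim : Tendsto (fun s => slope F t s - g s) (𝓝[≠] t) (𝓝 0) := by
    have habs : Tendsto (fun s => |s - t|) (𝓝[≠] t) (𝓝 0) := by
      have : Continuous fun s : ℝ => |s - t| := by fun_prop
      simpa using (this.tendsto t).mono_left nhdsWithin_le_nhds
    refine squeeze_zero_norm' ?_ (by simpa using hinf.add habs)
    filter_upwards [self_mem_nhdsWithin] with s hst
    rw [← dist_eq_norm]
    exact hg s hst
  obtain ⟨_, ⟨w, hw, rfl⟩, hcl⟩ := hA.2.2.exists_mapClusterPt (f := 𝓝[≠] t)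
    (u := fun s => toWeakSpace ℝ X (g s))
    (tendsto_principal.2 (Eventually.of_forall fun s => ⟨g s, hgA s, rfl⟩))
  refine ⟨w, hw, fun φ L hL => ?_⟩
  have h1 : Tendsto (fun s => φ (g s)) (𝓝[≠] t) (𝓝 L) := by
    have h2 := (hasDerivAt_iff_tendsto_slope.1 hL).sub ((φ.continuous.tendsto 0).comp hlim)
    rw [map_zero, sub_zero] at h2
    refine h2.congr fun s => ?_
    simp [slope]
  have h3 := hcl.continuousAt_comp
    (WeakBilin.eval_continuous (topDualPairing ℝ X).flip φ).continuousAt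
  exact eq_of_nhds_neBot (ClusterPt.mono h3 h1)

lemma IsCWK.exists_norm_sub_smul_lt {A B : Set X} (hA : IsCWK X A) (hB : IsCWK X B) {x : X}
    (hx : x ∈ A) {r c : ℝ} (hc : hausdorffDist A (r • B) < c) : ∃ y ∈ B, ‖x - r • y‖ < c := by
  obtain ⟨C₁, hC₁⟩ := hA.exists_norm_le
  obtain ⟨C₂, hC₂⟩ := hB.exists_norm_le
  have hfin : hausdorffEDist A (r • B) ≠ ⊤ :=
    hausdorffEDist_ne_top_of_nonempty_of_bounded hA.1 hB.1.smul_set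
      (isBounded_iff_forall_norm_le.2 ⟨C₁, hC₁⟩)
      ((isBounded_iff_forall_norm_le.2 ⟨C₂, hC₂⟩).smul₀ r)
  obtain ⟨_, ⟨y, hy, rfl⟩, h⟩ := exists_dist_lt_of_hausdorffDist_lt hx hc hfin
  exact ⟨y, hy, by rwa [← dist_eq_norm]⟩

end WeaklyCompact

section Selection

/-- A closed separable subspace has a dense sequence and a norming sequence of functionals. -/
lemma exists_dense_norming {Y : Submodule ℝ X}
    (hY : TopologicalSpace.IsSeparable (Y : Set X)) :
    ∃ y : ℕ → X, (∀ j, y j ∈ Y) ∧ (Y : Set X) ⊆ closure (range y) ∧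
      ∃ φ : ℕ → X →L[ℝ] ℝ, (∀ k, ‖φ k‖ ≤ 1) ∧
        ∀ v ∈ Y, ∀ c, (∀ k, |φ k v| ≤ c) → ‖v‖ ≤ c := by
  obtain ⟨T, hTY, hTc, hT⟩ := hY.exists_countable_dense_subset
  have hTne : T.Nonempty := closure_nonempty_iff.1 ⟨0, hT Y.zero_mem⟩
  obtain ⟨y, rfl⟩ := hTc.exists_eq_range hTne
  choose φ hφ hφy using fun k => exists_dual_vector'' ℝ (y k)
  refine ⟨y, fun j => hTY ⟨j, rfl⟩, hT, φ, hφ, fun v hv c hc => ?_⟩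
  refine le_of_forall_pos_le_add fun ε hε => ?_
  obtain ⟨_, ⟨k, rfl⟩, hk⟩ := Metric.mem_closure_iff.1 (hT hv) (ε / 2) (half_pos hε)
  rw [dist_eq_norm] at hk
  have h1 : ‖v‖ ≤ ‖v - y k‖ + ‖y k‖ := by simpa using norm_add_le (v - y k) (y k)
  have h2 : ‖y k‖ = φ k v - φ k (v - y k) := by
    rw [map_sub, sub_sub_cancel, hφy]; rfl
  have h3 := ((φ k).le_of_opNorm_le (hφ k) (v - y k)).trans_eq (one_mul _)
  rw [Real.norm_eq_abs] at h3
  linarith [neg_abs_le (φ k (v - y k)), le_abs_self (φ k v), hc k]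

/-- A point at which all functionals vanishing on a closed subspace vanish is in the subspace. -/
lemma mem_of_forall_clm_eq_zero {Y : Submodule ℝ X} (hY : IsClosed (Y : Set X)) {w : X}
    (h : ∀ φ : X →L[ℝ] ℝ, (∀ y ∈ Y, φ y = 0) → φ w = 0) : w ∈ Y := by
  by_contra hw
  obtain ⟨φ, u, hφ, hu⟩ := geometric_hahn_banach_closed_point Y.convex hY hw
  have h0 : 0 < u := by simpa using hφ 0 Y.zero_mem
  have hzero : ∀ y ∈ Y, φ y = 0 := by
    intro y hy
    by_contra hne
    have := hφ _ (Y.smul_mem (u / φ y) hy)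
    rw [map_smul, smul_eq_mul, div_mul_cancel₀ _ hne] at this
    exact lt_irrefl _ this
  rw [h φ hzero] at hu
  exact lt_asymm h0 hu

variable {Γ : ℝ → Set X} {F : ℝ → X} {g : ℝ → ℝ → ℝ → ℝ}

lemma norm_sub_sub_smul_le {C : ℝ → ℝ} (hC : ∀ t ∈ Icc (0:ℝ) 1, ∀ z ∈ Γ t, ‖z‖ ≤ C t)
    (hF : ∀ a b t, 0 ≤ a → a ≤ t → t ≤ b → b ≤ 1 → ∀ c, g a b t < c →
      ∃ z ∈ Γ t, ‖F b - F a - (b - a) • z‖ < c)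
    {a b t : ℝ} (ha : 0 ≤ a) (hat : a ≤ t) (htb : t ≤ b) (hb : b ≤ 1) {y : X} (hy : y ∈ Γ t) :
    ‖F b - F a - (b - a) • y‖ ≤ g a b t + (b - a) * (2 * C t) := by
  refine le_of_forall_pos_le_add fun ε hε => ?_
  obtain ⟨z, hz, hlt⟩ := hF a b t ha hat htb hb _ (lt_add_of_pos_right _ hε)
  have htI : t ∈ Icc (0:ℝ) 1 := ⟨ha.trans hat, htb.trans hb⟩
  have h1 : F b - F a - (b - a) • y = (F b - F a - (b - a) • z) + (b - a) • (z - y) := by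
    rw [smul_sub]; abel
  have h2 : ‖z - y‖ ≤ 2 * C t := by
    linarith [norm_sub_le z y, hC t htI z hz, hC t htI y hy]
  have hab : 0 ≤ b - a := by linarith
  rw [h1]
  refine (norm_add_le _ _).trans ?_
  rw [norm_smul, Real.norm_eq_abs, abs_of_nonneg hab]
  linarith [mul_le_mul_of_nonneg_left h2 hab]

/-- An interval function with small variation relative to `Γ` is continuous. -/
lemma continuousOn_of_variational (hg : ∀ a b t, 0 ≤ g a b t)
    (hvar : ∀ ε > 0, ∃ δ : ℝ → ℝ, IsGauge δ ∧ ∀ (n : ℕ) (P : TP n), P.IsPerron → P.IsFine δ →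
      ∑ i : Fin n, g (P.pt i.castSucc) (P.pt i.succ) (P.tag i) < ε)
    (hF : ∀ a b t, 0 ≤ a → a ≤ t → t ≤ b → b ≤ 1 → ∀ c, g a b t < c →
      ∃ z ∈ Γ t, ‖F b - F a - (b - a) • z‖ < c)
    {C : ℝ → ℝ} (hC : ∀ t ∈ Icc (0:ℝ) 1, ∀ z ∈ Γ t, ‖z‖ ≤ C t)
    (hΓ : ∀ t ∈ Icc (0:ℝ) 1, (Γ t).Nonempty) : ContinuousOn F (Icc 0 1) := by
  rw [Metric.continuousOn_iff]
  intro t ht ε hε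
  obtain ⟨δ, hδ, hsum⟩ := hvar (ε / 2) (half_pos hε)
  obtain ⟨V, -, hV, hgV⟩ := exists_monotoneOn_majorant hδ hg hsum
  obtain ⟨y, hy⟩ := hΓ t ht
  have hC0 : 0 ≤ C t := (norm_nonneg y).trans (hC t ht y hy)
  have hpos : 0 < 3 * C t + 1 := by positivity
  have key : ∀ a b, 0 ≤ a → a ≤ t → t ≤ b → b ≤ 1 → b - a < δ t →
      b - a < ε / 2 / (3 * C t + 1) → ‖F b - F a‖ < ε := by
    intro a b ha hat htb hb h1 h2
    have h3 := norm_sub_sub_smul_le hC hF ha hat htb hb hy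
    have h4 := hgV a b t ha hat htb hb fun z hz => ⟨by linarith [hz.1], by linarith [hz.2]⟩
    have h5 := hV a ⟨ha, (hat.trans htb).trans hb⟩
    have h6 := hV b ⟨ha.trans (hat.trans htb), hb⟩
    have hab : 0 ≤ b - a := by linarith
    have h7 : ‖F b - F a‖ ≤ ‖F b - F a - (b - a) • y‖ + ‖(b - a) • y‖ := by
      simpa using norm_add_le (F b - F a - (b - a) • y) ((b - a) • y)
    rw [norm_smul, Real.norm_eq_abs, abs_of_nonneg hab] at h7
    rw [lt_div_iff₀ hpos] at h2
    nlinarith [mul_le_mul_of_nonneg_left (hC t ht y hy) hab]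
  refine ⟨min (δ t) (ε / 2 / (3 * C t + 1)), lt_min (hδ t ht) (by positivity),
    fun s hs hst => ?_⟩
  rw [Real.dist_eq] at hst
  have h1 := hst.trans_le (min_le_left _ _)
  have h2 := hst.trans_le (min_le_right _ _)
  rcases le_total t s with h | h
  · rw [abs_of_nonneg (sub_nonneg.2 h)] at h1 h2
    rw [dist_eq_norm]
    exact key t s ht.1 le_rfl h hs.2 h1 h2
  · rw [abs_sub_comm, abs_of_nonneg (sub_nonneg.2 h)] at h1 h2
    rw [dist_comm, dist_eq_norm]
    exact key s t hs.1 h le_rfl ht.2 h1 h2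

lemma ae_eventually_exists_norm_sub_le (hg : ∀ a b t, 0 ≤ g a b t)
    (hvar : ∀ ε > 0, ∃ δ : ℝ → ℝ, IsGauge δ ∧ ∀ (n : ℕ) (P : TP n), P.IsPerron → P.IsFine δ →
      ∑ i : Fin n, g (P.pt i.castSucc) (P.pt i.succ) (P.tag i) < ε)
    (hF : ∀ a b t, 0 ≤ a → a ≤ t → t ≤ b → b ≤ 1 → ∀ c, g a b t < c →
      ∃ z ∈ Γ t, ‖F b - F a - (b - a) • z‖ < c)
    (hΓ : ∀ t ∈ Icc (0:ℝ) 1, (Γ t).Nonempty) :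
    ∀ᵐ t : ℝ, t ∈ Ioo (0:ℝ) 1 → ∀ ε > 0, ∀ᶠ s in 𝓝 t,
      ∃ z ∈ Γ t, ‖F s - F t - (s - t) • z‖ ≤ ε * |s - t| := by
  filter_upwards [ae_forall_exists_le_mul_sub hg hvar] with t ht ht01 ε hε
  obtain ⟨η, hη, hle⟩ := ht ht01 (ε / 2) (half_pos hε)
  filter_upwards [Metric.ball_mem_nhds t hη, Icc_mem_nhds ht01.1 ht01.2] with s hs hs01
  rw [mem_ball, Real.dist_eq] at hs
  rcases lt_trichotomy t s with h | rfl | h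
  · rw [abs_of_pos (sub_pos.2 h)] at hs ⊢
    obtain ⟨z, hz, hlt⟩ := hF t s t ht01.1.le le_rfl h.le hs01.2 (ε * (s - t))
      ((hle t s ht01.1.le le_rfl h.le hs01.2 hs).trans_lt (by nlinarith))
    exact ⟨z, hz, hlt.le⟩
  · obtain ⟨z, hz⟩ := hΓ t (Ioo_subset_Icc_self ht01)
    exact ⟨z, hz, by simp⟩
  · rw [abs_sub_comm, abs_of_pos (sub_pos.2 h)] at hs ⊢
    obtain ⟨z, hz, hlt⟩ := hF s t t hs01.1 h.le le_rfl ht01.2.le (ε * (t - s))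
      ((hle s t hs01.1 h.le le_rfl ht01.2.le hs).trans_lt (by nlinarith))
    refine ⟨z, hz, ?_⟩
    have : F s - F t - (s - t) • z = -(F t - F s - (t - s) • z) := by
      rw [sub_smul, sub_smul]; abel
    rw [this, norm_neg]
    exact hlt.le

/-- A selection which is almost everywhere the derivative of `F` is variationally Henstock
integrable with primitive `F`. -/
lemma fvHIntegrable_of_ae_hasDerivAt (hg : ∀ a b t, 0 ≤ g a b t)
    (hvar : ∀ ε > 0, ∃ δ : ℝ → ℝ, IsGauge δ ∧ ∀ (n : ℕ) (P : TP n), P.IsPerron → P.IsFine δ →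
      ∑ i : Fin n, g (P.pt i.castSucc) (P.pt i.succ) (P.tag i) < ε)
    (hF : ∀ a b t, 0 ≤ a → a ≤ t → t ≤ b → b ≤ 1 → ∀ c, g a b t < c →
      ∃ z ∈ Γ t, ‖F b - F a - (b - a) • z‖ < c)
    {C : ℝ → ℝ} (hC : ∀ t ∈ Icc (0:ℝ) 1, ∀ z ∈ Γ t, ‖z‖ ≤ C t)
    {f : ℝ → X} (hf : Selection Γ f)
    (hder : ∀ᵐ t : ℝ, t ∈ Ioo (0:ℝ) 1 → HasDerivAt F (f t) t) : FvHIntegrable f := by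
  refine ⟨fun a b => F b - F a, fun a b c _ _ _ _ => by simp only; abel, fun ε hε => ?_⟩
  have hε' : 0 < ε / 4 := by positivity
  set N : Set ℝ := {t | ¬(t ∈ Ioo (0:ℝ) 1 → HasDerivAt F (f t) t)} ∪ {0, 1} with hN
  have hN0 : volume N = 0 :=
    measure_union_null (ae_iff.1 hder) ((Set.toFinite {(0:ℝ), 1}).measure_zero _)
  obtain ⟨δ₁, hδ₁, hsum⟩ := hvar (ε / 4) hε'
  obtain ⟨V, hVm, hV, hgV⟩ := exists_monotoneOn_majorant hδ₁ hg hsum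
  obtain ⟨w, hwm, hw, δ₂, hδ₂, hwN⟩ := exists_monotone_of_null hN0 (fun t => 2 * C t) hε'
  have hex : ∀ t, ∃ δ > 0, t ∈ Icc (0:ℝ) 1 → t ∉ N → ∀ s, |s - t| < δ →
      ‖F s - F t - (s - t) • f t‖ ≤ ε / 4 * |s - t| := by
    intro t
    by_cases h : t ∈ Icc (0:ℝ) 1 ∧ t ∉ N
    · obtain ⟨ht, htN⟩ := h
      simp only [hN, mem_union, mem_ofPred_eq, mem_insert_iff, mem_singleton_iff, not_or,
        not_not] at htN
      have hd := htN.1 ⟨ht.1.lt_of_ne' htN.2.1, ht.2.lt_of_ne htN.2.2⟩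
      obtain ⟨δ, hδ, hb⟩ :=
        Metric.eventually_nhds_iff.1 ((hasDerivAt_iff_isLittleO.1 hd).def hε')
      exact ⟨δ, hδ, fun _ _ s hs => hb (y := s) (by rwa [Real.dist_eq])⟩
    · exact ⟨1, one_pos, fun h1 h2 => absurd ⟨h1, h2⟩ h⟩
  choose δ₃ hδ₃ hd₃ using hex
  set W : ℝ → ℝ := fun x => V x + w x + ε / 4 * x with hW
  refine ⟨fun t => min (δ₁ t) (min (δ₂ t) (δ₃ t)),
    fun t ht => lt_min (hδ₁ t ht) (lt_min (hδ₂ t) (hδ₃ t)), fun n P hP hfine => ?_⟩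
  have hpt : ∀ i, P.pt i ∈ Icc (0:ℝ) 1 := fun i =>
    ⟨P.first ▸ P.mono (Fin.zero_le i), P.last ▸ P.mono (Fin.le_last i)⟩
  have hterm : ∀ i : Fin n, ‖F (P.pt i.succ) - F (P.pt i.castSucc) - P.len i • f (P.tag i)‖
      ≤ W (P.pt i.succ) - W (P.pt i.castSucc) := by
    intro i
    have hat := (hP i).1
    have htb := (hP i).2
    have hIoo := hfine i
    have haI := hpt i.castSucc
    have hbI := hpt i.succ
    have htI := P.tagMem i
    simp only [TP.len, TP.ivl] at hIoo ⊢
    generalize P.pt i.castSucc = a at *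
    generalize P.pt i.succ = b at *
    generalize P.tag i = t at *
    have hab : a ≤ b := hat.trans htb
    have hfine' : ∀ {ρ}, min (δ₁ t) (min (δ₂ t) (δ₃ t)) ≤ ρ →
        Icc a b ⊆ Ioo (t - ρ) (t + ρ) := fun h =>
      hIoo.trans (Ioo_subset_Ioo (by linarith) (by linarith))
    have hV' := hVm haI hbI hab
    have hw' := hwm hab
    by_cases htN : t ∈ N
    · have h1 := norm_sub_sub_smul_le hC hF haI.1 hat htb hbI.2 (hf t htI)
      have h2 := hgV a b t haI.1 hat htb hbI.2 (hfine' (min_le_left _ _))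
      have h3 := hwN t htN a b hab (hfine' ((min_le_right _ _).trans (min_le_left _ _)))
      simp only [hW]
      nlinarith
    · have hsub := hfine' ((min_le_right _ _).trans (min_le_right _ _))
      have hlt : ∀ s ∈ Icc a b, |s - t| < δ₃ t := fun s hs => by
        have := hsub hs
        rw [abs_lt]
        constructor <;> linarith [this.1, this.2]
      have h1 := hd₃ t htI htN a (hlt a ⟨le_rfl, hab⟩)
      have h2 := hd₃ t htI htN b (hlt b ⟨hab, le_rfl⟩)
      rw [abs_of_nonpos (sub_nonpos.2 hat)] at h1
      rw [abs_of_nonneg (sub_nonneg.2 htb)] at h2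
      have h3 : F b - F a - (b - a) • f t
          = (F b - F t - (b - t) • f t) - (F a - F t - (a - t) • f t) := by
        simp only [sub_smul]; abel
      rw [h3]
      refine (norm_sub_le _ _).trans ?_
      simp only [hW]
      linarith
  refine (Finset.sum_le_sum fun i _ => hterm i).trans_lt ?_
  rw [sum_succ_sub_castSucc fun i => W (P.pt i), P.first, P.last]
  simp only [hW]
  linarith [(hV 1 ⟨zero_le_one, le_rfl⟩).2, (hV 0 ⟨le_rfl, zero_le_one⟩).1]

end Selection

/-- Corollary to Theorem `T4.1` of the paper. Every variationally Henstock
integrable multifunction `Γ : [0,1] → cwk(X)` possesses a variationally Henstock integrable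
selection. -/
theorem vH_selection_exists
    {X : Type*} [NormedAddCommGroup X] [NormedSpace ℝ X] [CompleteSpace X]
    (Γ : ℝ → Set X) (hΓ : ∀ t ∈ Icc (0:ℝ) 1, IsCWK X (Γ t))
    (h : vHIntegrable Γ) :
    ∃ f : ℝ → X, Selection Γ f ∧ FvHIntegrable f := by
  obtain ⟨Φ, hcwk, hadd, hvar⟩ := h
  obtain ⟨F, hFΦ, hF0⟩ := hadd.exists_selection (hcwk 0 1 le_rfl zero_le_one le_rfl)
  set g : ℝ → ℝ → ℝ → ℝ := fun a b t => hausdorffDist (Φ a b) ((b - a) • Γ t) with hgdef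
  have hg : ∀ a b t, 0 ≤ g a b t := fun a b t => hausdorffDist_nonneg
  have hF : ∀ a b t, 0 ≤ a → a ≤ t → t ≤ b → b ≤ 1 → ∀ c, g a b t < c →
      ∃ z ∈ Γ t, ‖F b - F a - (b - a) • z‖ < c := fun a b t ha hat htb hb c hc =>
    (hcwk a b ha (hat.trans htb) hb).exists_norm_sub_smul_lt
      (hΓ t ⟨ha.trans hat, htb.trans hb⟩) (hFΦ a b ha (hat.trans htb) hb) hc
  have hne : ∀ t ∈ Icc (0:ℝ) 1, (Γ t).Nonempty := fun t ht => (hΓ t ht).1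
  choose! C hC using fun t ht => (hΓ t ht).exists_norm_le
  have hcont := continuousOn_of_variational hg hvar hF hC hne
  set Y : Submodule ℝ X := (Submodule.span ℝ (F '' Icc 0 1)).topologicalClosure
  have hYsep : TopologicalSpace.IsSeparable (Y : Set X) :=
    ((isCompact_Icc.image_of_continuousOn hcont).isSeparable.span (R := ℝ)).closure
  have hFY : ∀ s, F s ∈ Y := by
    intro s
    by_cases hs : s ∈ Icc (0:ℝ) 1
    · exact Submodule.le_topologicalClosure _ (Submodule.subset_span ⟨s, hs, rfl⟩)
    · rw [hF0 s hs]
      exact Y.zero_mem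
  have hYcl : IsClosed (Y : Set X) := Submodule.isClosed_topologicalClosure _
  obtain ⟨y, hyY, hy, φ, hφ, hnorm⟩ := exists_dense_norming hYsep
  have hsmall := ae_eventually_exists_norm_sub_le hg hvar hF hne
  set B : Set ℝ := {t | t ∈ Ioo (0:ℝ) 1 ∧ (∀ ε > 0, ∀ᶠ s in 𝓝 t,
    ∃ z ∈ Γ t, ‖F s - F t - (s - t) • z‖ ≤ ε * |s - t|)} with hB
  have hBlip : ∀ t ∈ B, ∃ M : ℝ, ∀ᶠ s in 𝓝 t, ‖F s - F t‖ ≤ M * |s - t| := by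
    intro t ht
    refine ⟨1 + C t, ?_⟩
    filter_upwards [ht.2 1 one_pos] with s ⟨z, hz, hs⟩
    have h1 : ‖F s - F t‖ ≤ ‖F s - F t - (s - t) • z‖ + ‖(s - t) • z‖ := by
      simpa using norm_add_le (F s - F t - (s - t) • z) ((s - t) • z)
    rw [norm_smul, Real.norm_eq_abs] at h1
    have h2 := hC t (Ioo_subset_Icc_self ht.1) z hz
    nlinarith [abs_nonneg (s - t)]
  have hBdiff := ae_forall_differentiableAt hBlip hφ
  have hsel : ∀ t, ∃ w, (t ∈ Icc (0:ℝ) 1 → w ∈ Γ t) ∧ (t ∈ B → ∀ (ψ : X →L[ℝ] ℝ) (L : ℝ),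
      HasDerivAt (fun s => ψ (F s)) L t → ψ w = L) := by
    intro t
    by_cases htB : t ∈ B
    · obtain ⟨w, hw, hwd⟩ := (hΓ t (Ioo_subset_Icc_self htB.1)).exists_scalar_deriv htB.2
      exact ⟨w, fun _ => hw, fun _ => hwd⟩
    · by_cases ht : t ∈ Icc (0:ℝ) 1
      · obtain ⟨w, hw⟩ := hne t ht
        exact ⟨w, fun _ => hw, fun h => absurd h htB⟩
      · exact ⟨0, fun h => absurd h ht, fun h => absurd h htB⟩
  choose f hfΓ hfd using hsel
  refine ⟨f, hfΓ, fvHIntegrable_of_ae_hasDerivAt hg hvar hF hC hfΓ ?_⟩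
  have hfY : ∀ t ∈ B, f t ∈ Y := fun t ht => mem_of_forall_clm_eq_zero hYcl fun ψ hψ =>
    hfd t ht ψ 0 (by simpa only [hψ _ (hFY _)] using hasDerivAt_const t (0:ℝ))
  have hderiv := ae_hasDerivAt (f := f)
    (B := {t | t ∈ B ∧ ∀ k, DifferentiableAt ℝ (fun s => φ k (F s)) t})
    (fun t ht => hBlip t ht.1) hφ hnorm hFY hyY hy (fun t ht => hfY t ht.1) (fun t ht k => by
      have hd := (ht.2 k).hasDerivAt
      rwa [← hfd t ht.1 (φ k) _ hd] at hd)
  filter_upwards [hsmall, hBdiff, hderiv] with t h1 h2 h3 ht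
  have htB : t ∈ B := ⟨ht, h1 ht⟩
  exact h3 ⟨htB, h2 htB⟩

end GaugePaper
end
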